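/- arXiv:math/0309449 — 4 statements merged into one kernel-verified Lean document; each statement's English description precedes it below -/
import Mathlib

section
/- Let R : ℝ^d → (0,∞) be 1-Lipschitz, let S ⊂ ℝ^d be a countable locally finite set such that the balls B(s; R(s)/4) cover ℝ^d and the balls B(s; R(s)/2) have multiplicity bounded by a dimensional constant. Then there exist constants c, C > 0 (depending only on d) and C² functions f_s : ℝ^d → [0,1] for s ∈ S such that: (a) f_s(x) = 0 unless x ∈ B(s; R(s)/2); (b) ∑_{s∈S} f_s(x) = 1 for all x ∈ ℝ^d; (c) ∫ f_s dm ≥ c·R(s)^d for all s ∈ S; (d) sup_x |∇f_s(x)| ≤ C/R(s) and sup_x |∇²f_s(x)| ≤ C/R(s)² for all s ∈ S. -/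
open Metric MeasureTheory

section Auxiliary

variable {E : Type*} [NormedAddCommGroup E] [NormedSpace ℝ E]

/-- A function vanishing off a closed set has vanishing derivative there. -/
lemma fderiv_eq_zero_of_notMem_of_isClosed {F : Type*} [NormedAddCommGroup F] [NormedSpace ℝ F]
    {g : E → F} {K : Set E} (hK : IsClosed K) (h : ∀ x ∉ K, g x = 0) {x : E} (hx : x ∉ K) :
    fderiv ℝ g x = 0 := by
  have : g =ᶠ[nhds x] fun _ => 0 := by
    filter_upwards [hK.isOpen_compl.mem_nhds hx] with y hy using h y hy
  rw [this.fderiv_eq, fderiv_fun_const, Pi.zero_apply]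

/-- A sum with at most `M` nonvanishing terms, each of norm at most `B`. -/
lemma norm_sum_le_of_encard_le {ι F : Type*} [NormedAddCommGroup F] (T : Finset ι) (v : ι → F)
    (P : ι → Prop) {M : ℕ} (hP : {i | P i}.encard ≤ (M : ℕ∞)) {B : ℝ} (hB : 0 ≤ B)
    (h0 : ∀ i, ¬ P i → v i = 0) (hv : ∀ i, P i → ‖v i‖ ≤ B) :
    ‖∑ i ∈ T, v i‖ ≤ M * B := by
  classical
  have hcard : (T.filter P).card ≤ M := by
    have h : ((T.filter P : Finset ι) : Set ι).encard ≤ (M : ℕ∞) :=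
      (Set.encard_le_encard fun i hi => (Finset.mem_filter.1 hi).2).trans hP
    rw [Set.encard_coe_eq_coe_finsetCard] at h
    exact_mod_cast h
  have hsum : ∑ i ∈ T.filter P, v i = ∑ i ∈ T, v i :=
    Finset.sum_filter_of_ne fun i _ hi => by
      by_contra hPi
      exact hi (h0 i hPi)
  rw [← hsum]
  calc ‖∑ i ∈ T.filter P, v i‖ ≤ ∑ i ∈ T.filter P, B :=
        norm_sum_le_of_le _ fun i hi => hv i (Finset.mem_filter.1 hi).2
    _ = (T.filter P).card * B := by rw [Finset.sum_const, nsmul_eq_mul]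
    _ ≤ M * B := by gcongr

lemma norm_inv_smul_le {r a : ℝ} (hr : 0 < r) {w : E} (hw : ‖w‖ ≤ a) : ‖r⁻¹ • w‖ ≤ a / r := by
  rw [norm_smul, norm_inv, Real.norm_of_nonneg hr.le, inv_mul_eq_div]
  exact div_le_div_of_nonneg_right hw hr.le

lemma norm_le_of_eq_smul_add {w w' u u' v : E} {a b : ℝ} (ha : 1 ≤ a) (hb : |b| ≤ 1)
    (h : v = (a • w + u) + (b • w' + u')) : ‖w‖ ≤ ‖v‖ + ‖u‖ + ‖w'‖ + ‖u'‖ := by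
  have e : a • w = v - u - b • w' - u' := by rw [h]; abel
  have h1 : ‖w‖ ≤ ‖a • w‖ := by
    rw [norm_smul, Real.norm_of_nonneg (zero_le_one.trans ha)]
    exact le_mul_of_one_le_left (norm_nonneg _) ha
  have h2 : ‖b • w'‖ ≤ ‖w'‖ := by
    rw [norm_smul]
    exact mul_le_of_le_one_left (norm_nonneg _) hb
  rw [e] at h1
  linarith [norm_sub_le (v - u - b • w') u', norm_sub_le (v - u) (b • w'), norm_sub_le v u]

/-- The derivative of a function composed with an affine scaling. -/
lemma fderiv_comp_inv_smul_sub {F : Type*} [NormedAddCommGroup F] [NormedSpace ℝ F]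
    {g : E → F} (hg : Differentiable ℝ g) (r : ℝ) (s : E) :
    fderiv ℝ (fun x => g (r • (x - s))) = fun x => r • fderiv ℝ g (r • (x - s)) := by
  ext1 x
  have h : HasFDerivAt (fun x : E => r • (x - s)) (r • ContinuousLinearMap.id ℝ E) x :=
    ((hasFDerivAt_id x).sub_const s).const_smul r
  refine ((hg _).hasFDerivAt.comp x h).fderiv.trans ?_
  ext v
  simp

/-- Bounds on the first two derivatives of a quotient `p / q` with values in `[0, 1]` and with
denominator at least `1`. -/
lemma norm_fderiv_div_le {p q : E → ℝ} (hp : ContDiff ℝ 2 p) (hq : ContDiff ℝ 2 q)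
    (hq1 : ∀ x, 1 ≤ q x) {x : E} (hf : |p x / q x| ≤ 1) {a₁ a₂ b₁ b₂ : ℝ}
    (ha₁ : ‖fderiv ℝ p x‖ ≤ a₁) (ha₂ : ‖fderiv ℝ (fderiv ℝ p) x‖ ≤ a₂)
    (hb₁ : ‖fderiv ℝ q x‖ ≤ b₁) (hb₂ : ‖fderiv ℝ (fderiv ℝ q) x‖ ≤ b₂) :
    ‖fderiv ℝ (fun y => p y / q y) x‖ ≤ a₁ + b₁ ∧
      ‖fderiv ℝ (fderiv ℝ (fun y => p y / q y)) x‖ ≤ a₂ + 2 * (a₁ + b₁) * b₁ + b₂ := by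
  have hq0 : ∀ y, q y ≠ 0 := fun y => (zero_lt_one.trans_le (hq1 y)).ne'
  set f : E → ℝ := fun y => p y / q y with hfdef
  have hfC : ContDiff ℝ 2 f := hp.div hq hq0
  have hd : ∀ {g : E → ℝ}, ContDiff ℝ 2 g → Differentiable ℝ g := fun h =>
    h.differentiable (by norm_num)
  have hd2 : ∀ {g : E → ℝ}, ContDiff ℝ 2 g → Differentiable ℝ (fderiv ℝ g) := fun h =>
    (h.fderiv_right (m := 1) (by norm_num)).differentiable (by norm_num)
  have hpq : p = fun y => q y * f y := by
    ext y
    simp only [hfdef]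
    field_simp [hq0 y]
  have h1 : fderiv ℝ p = fun y => q y • fderiv ℝ f y + f y • fderiv ℝ q y := by
    ext1 y
    rw [hpq]
    exact fderiv_fun_mul (hd hq y) (hd hfC y)
  have h2 : fderiv ℝ (fderiv ℝ p) x =
      (q x • fderiv ℝ (fderiv ℝ f) x + (fderiv ℝ q x).smulRight (fderiv ℝ f x)) +
      (f x • fderiv ℝ (fderiv ℝ q) x + (fderiv ℝ f x).smulRight (fderiv ℝ q x)) := by
    rw [h1]
    exact (((hd hq x).hasFDerivAt.smul (hd2 hfC x).hasFDerivAt).add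
      ((hd hfC x).hasFDerivAt.smul (hd2 hq x).hasFDerivAt)).fderiv
  have B1 : ‖fderiv ℝ f x‖ ≤ a₁ + b₁ := by
    have h := norm_le_of_eq_smul_add (u := (0 : E →L[ℝ] ℝ)) (u' := 0) (hq1 x) hf
      (by simpa only [add_zero] using congrFun h1 x)
    simp only [norm_zero, add_zero] at h
    linarith
  have hprod : ‖fderiv ℝ f x‖ * ‖fderiv ℝ q x‖ ≤ (a₁ + b₁) * b₁ :=
    mul_le_mul B1 hb₁ (norm_nonneg _) ((norm_nonneg _).trans B1)
  have n1 := ContinuousLinearMap.norm_smulRight_apply (fderiv ℝ q x) (fderiv ℝ f x)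
  have n2 := ContinuousLinearMap.norm_smulRight_apply (fderiv ℝ f x) (fderiv ℝ q x)
  have B2 := norm_le_of_eq_smul_add (E := E →L[ℝ] E →L[ℝ] ℝ) (hq1 x) hf h2
  exact ⟨B1, by linarith [mul_comm ‖fderiv ℝ q x‖ ‖fderiv ℝ f x‖]⟩

/-- Bounds on the value and the first two derivatives of a locally finite sum of multiplicity at
most `M`. -/
lemma locallyFinite_tsum_bounds {ι : Type*} {u : ι → E → ℝ} (hu : ∀ i, ContDiff ℝ 2 (u i))
    {K : ι → Set E} (hK : ∀ i, IsClosed (K i)) (hu0 : ∀ i, ∀ x ∉ K i, u i x = 0)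
    (hfin : ∀ x, ∃ T : Finset ι, ∀ᶠ y in nhds x, ∀ i ∉ T, u i y = 0)
    {M : ℕ} (hM : ∀ x, {i | x ∈ K i}.encard ≤ (M : ℕ∞)) :
    ContDiff ℝ 2 (fun x => ∑' i, u i x) ∧ ∀ x, ∀ B₀ B₁ B₂ : ℝ, 0 ≤ B₀ → 0 ≤ B₁ → 0 ≤ B₂ →
      (∀ i, x ∈ K i → ‖u i x‖ ≤ B₀) → (∀ i, x ∈ K i → ‖fderiv ℝ (u i) x‖ ≤ B₁) →
      (∀ i, x ∈ K i → ‖fderiv ℝ (fderiv ℝ (u i)) x‖ ≤ B₂) →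
      ‖∑' i, u i x‖ ≤ M * B₀ ∧ ‖fderiv ℝ (fun x => ∑' i, u i x) x‖ ≤ M * B₁ ∧
      ‖fderiv ℝ (fderiv ℝ (fun x => ∑' i, u i x)) x‖ ≤ M * B₂ := by
  choose T hT using hfin
  have hloc : ∀ x, (fun y => ∑' i, u i y) =ᶠ[nhds x] fun y => ∑ i ∈ T x, u i y := fun x => by
    filter_upwards [hT x] with y hy
    exact tsum_eq_sum hy
  have hd : ∀ i, Differentiable ℝ (u i) := fun i => (hu i).differentiable (by norm_num)
  have hd2 : ∀ i, Differentiable ℝ (fderiv ℝ (u i)) := fun i =>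
    ((hu i).fderiv_right (m := 1) (by norm_num)).differentiable (by norm_num)
  have hz1 : ∀ i, ∀ x ∉ K i, fderiv ℝ (u i) x = 0 := fun i x hx =>
    fderiv_eq_zero_of_notMem_of_isClosed (hK i) (hu0 i) hx
  have hz2 : ∀ i, ∀ x ∉ K i, fderiv ℝ (fderiv ℝ (u i)) x = 0 := fun i x hx =>
    fderiv_eq_zero_of_notMem_of_isClosed (hK i) (hz1 i) hx
  refine ⟨contDiff_iff_contDiffAt.2 fun x =>
    ((ContDiff.sum fun i _ => hu i).contDiffAt).congr_of_eventuallyEq (hloc x), ?_⟩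
  intro x B₀ B₁ B₂ p₀ p₁ p₂ h₀ h₁ h₂
  have hs : fderiv ℝ (fun y => ∑ i ∈ T x, u i y) = fun y => ∑ i ∈ T x, fderiv ℝ (u i) y := by
    ext1 y
    exact fderiv_fun_sum fun i _ => hd i y
  refine ⟨?_, ?_, ?_⟩
  · rw [(hloc x).eq_of_nhds]
    exact norm_sum_le_of_encard_le _ _ _ (hM x) p₀ (fun i => hu0 i x) h₀
  · rw [(hloc x).fderiv_eq, hs]
    exact norm_sum_le_of_encard_le _ _ _ (hM x) p₁ (fun i => hz1 i x) h₁
  · rw [(hloc x).fderiv.fderiv_eq, hs, fderiv_fun_sum fun i _ => hd2 i x]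
    exact norm_sum_le_of_encard_le (F := E →L[ℝ] E →L[ℝ] ℝ) _ _ _ (hM x) p₂ (fun i => hz2 i x) h₂

lemma exists_bound_fderiv_of_hasCompactSupport {g : E → ℝ} (hg : ContDiff ℝ 2 g)
    (hc : HasCompactSupport g) : ∃ A : ℝ, 0 < A ∧ (∀ x, ‖fderiv ℝ g x‖ ≤ A) ∧
      ∀ x, ‖fderiv ℝ (fderiv ℝ g) x‖ ≤ A := by
  have hg1 : ContDiff ℝ 1 (fderiv ℝ g) := hg.fderiv_right (by norm_num)
  have hc1 : HasCompactSupport (fderiv ℝ g) := hc.fderiv (𝕜 := ℝ)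
  have hc2 : HasCompactSupport (fderiv ℝ (fderiv ℝ g)) := hc1.fderiv (𝕜 := ℝ)
  have hg2 : Continuous (fderiv ℝ (fderiv ℝ g)) := hg1.continuous_fderiv (by norm_num)
  have hb1 : ∃ A : ℝ, ∀ x, ‖fderiv ℝ g x‖ ≤ A := hc1.exists_bound_of_continuous hg1.continuous
  have hb2 : ∃ A : ℝ, ∀ x, ‖fderiv ℝ (fderiv ℝ g) x‖ ≤ A :=
    HasCompactSupport.exists_bound_of_continuous (E := E →L[ℝ] E →L[ℝ] ℝ) hc2 hg2
  obtain ⟨A₁, hA₁⟩ := hb1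
  obtain ⟨A₂, hA₂⟩ := hb2
  exact ⟨max (max A₁ A₂) 1, lt_max_of_lt_right one_pos,
    fun x => (hA₁ x).trans ((le_max_left _ _).trans (le_max_left _ _)),
    fun x => (hA₂ x).trans ((le_max_right _ _).trans (le_max_left _ _))⟩

end Auxiliary

/-- A `C²` bump function equal to `1` on `B(0; 1/4)`, supported in `B(0; 1/2)`, and with bounded
derivatives. -/
lemma exists_contDiff_bump (d : ℕ) : ∃ (φ : EuclideanSpace ℝ (Fin d) → ℝ) (A : ℝ), 0 < A ∧
    ContDiff ℝ 2 φ ∧ (∀ x, 0 ≤ φ x) ∧ (∀ x, φ x ≤ 1) ∧ (∀ x, ‖x‖ ≤ 1 / 4 → φ x = 1) ∧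
    (∀ x, 1 / 2 < ‖x‖ → φ x = 0) ∧ (∀ x, ‖fderiv ℝ φ x‖ ≤ A) ∧
    (∀ x, ‖fderiv ℝ (fderiv ℝ φ) x‖ ≤ A) ∧ 0 < ∫ x, φ x := by
  obtain ⟨b, hin, hout⟩ : ∃ b : ContDiffBump (0 : EuclideanSpace ℝ (Fin d)),
      b.rIn = 1 / 4 ∧ b.rOut = 1 / 2 := ⟨⟨1 / 4, 1 / 2, by norm_num, by norm_num⟩, rfl, rfl⟩
  have hb : ContDiff ℝ 2 b := b.contDiff
  obtain ⟨A, hA, h₁, h₂⟩ := exists_bound_fderiv_of_hasCompactSupport hb b.hasCompactSupport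
  exact ⟨b, A, hA, hb, fun _ => b.nonneg, fun _ => b.le_one,
    fun x hx => b.one_of_mem_closedBall (by rwa [mem_closedBall_zero_iff, hin]),
    fun x hx => b.zero_of_le_dist (by rw [dist_zero_right, hout]; exact hx.le),
    h₁, h₂, b.integral_pos⟩

set_option maxHeartbeats 400000 in
/-- Whitney-type partition of unity.  Given the dimension `d` and a
multiplicity bound `M`, there are constants `c, C > 0` such that for every positive
1-Lipschitz `R` and every countable locally finite set `S` with the covering and
bounded-multiplicity properties of Lemma 2.2, there are C² functions
`f s : ℝ^d → [0,1]` (`s ∈ S`) such that: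
(a) `f s` vanishes outside `B(s; R(s)/2)`;
(b) `∑_{s ∈ S} f s x = 1` for every `x`;
(c) `∫ f s dm ≥ c · R(s)^d`;
(d) `‖∇ (f s)‖ ≤ C / R(s)` and `‖∇² (f s)‖ ≤ C / R(s)²` everywhere. -/
theorem stmt_5 (d M : ℕ) :
    ∃ c C : ℝ, 0 < c ∧ 0 < C ∧
    ∀ R : EuclideanSpace ℝ (Fin d) → ℝ, LipschitzWith 1 R → (∀ x, 0 < R x) →
    ∀ S : Set (EuclideanSpace ℝ (Fin d)), S.Countable →
      (∀ K : Set (EuclideanSpace ℝ (Fin d)), IsCompact K → (S ∩ K).Finite) →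
      (∀ x, ∃ s ∈ S, x ∈ closedBall s (R s / 4)) →
      (∀ x, ({s ∈ S | x ∈ closedBall s (R s / 2)}).encard ≤ (M : ℕ∞)) →
      ∃ f : EuclideanSpace ℝ (Fin d) → EuclideanSpace ℝ (Fin d) → ℝ,
        (∀ s ∈ S, ContDiff ℝ 2 (f s)) ∧
        (∀ s ∈ S, ∀ x, f s x ∈ Set.Icc (0:ℝ) 1) ∧
        (∀ s ∈ S, ∀ x, x ∉ closedBall s (R s / 2) → f s x = 0) ∧
        (∀ x, ∑' s : S, f s x = 1) ∧
        (∀ s ∈ S, c * R s ^ d ≤ ∫ x, f s x) ∧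
        (∀ s ∈ S, ∀ x, ‖fderiv ℝ (f s) x‖ ≤ C / R s) ∧
        (∀ s ∈ S, ∀ x, ‖fderiv ℝ (fderiv ℝ (f s)) x‖ ≤ C / R s ^ 2) := by
  obtain ⟨φ, A, hA, hφC, hφ0, hφ1, hφin, hφout, hφA₁, hφA₂, hφI⟩ := exists_contDiff_bump d
  set C₁ : ℝ := A + M * (3 * A) with hC₁
  set C₂ : ℝ := A + 2 * (A + M * (3 * A)) * (M * (3 * A)) + M * (9 * A) with hC₂
  have hC₁0 : 0 < C₁ := by positivity
  have hC₂0 : 0 < C₂ := by positivity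
  refine ⟨(∫ x, φ x) / (M + 1), C₁ + C₂, by positivity, by positivity, ?_⟩
  intro R hR hR0 S _ hSfin hcov hmult
  have hRd : ∀ x y, R x ≤ R y + dist x y := fun x y => by
    have h := hR.dist_le_mul x y
    rw [Real.dist_eq, NNReal.coe_one, one_mul] at h
    linarith [le_abs_self (R x - R y)]
  set ψ : EuclideanSpace ℝ (Fin d) → EuclideanSpace ℝ (Fin d) → ℝ :=
    fun s x => φ ((R s)⁻¹ • (x - s)) with hψ
  have hnorm : ∀ s x, ‖(R s)⁻¹ • (x - s)‖ = dist x s / R s := fun s x => by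
    rw [norm_smul, norm_inv, Real.norm_of_nonneg (hR0 s).le, dist_eq_norm, inv_mul_eq_div]
  have hψC : ∀ s, ContDiff ℝ 2 (ψ s) := fun s =>
    hφC.comp ((contDiff_id.sub contDiff_const).const_smul _)
  have hψout : ∀ s, ∀ x ∉ closedBall s (R s / 2), ψ s x = 0 := fun s x hx => by
    refine hφout _ ?_
    rw [hnorm, lt_div_iff₀ (hR0 s)]
    rw [mem_closedBall, not_le] at hx
    linarith
  have hψin : ∀ s, ∀ x ∈ closedBall s (R s / 4), ψ s x = 1 := fun s x hx => by
    refine hφin _ ?_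
    rw [hnorm, div_le_iff₀ (hR0 s)]
    rw [mem_closedBall] at hx
    linarith
  have hD1 : ∀ s, fderiv ℝ (ψ s) = fun x => (R s)⁻¹ • fderiv ℝ φ ((R s)⁻¹ • (x - s)) := fun s =>
    fderiv_comp_inv_smul_sub (hφC.differentiable (by norm_num)) _ _
  have hφD : Differentiable ℝ (fderiv ℝ φ) :=
    (hφC.fderiv_right (m := 1) (by norm_num)).differentiable (by norm_num)
  have hψA₁ : ∀ s x, ‖fderiv ℝ (ψ s) x‖ ≤ A / R s := fun s x => by
    rw [hD1]
    exact norm_inv_smul_le (hR0 s) (hφA₁ _)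
  have hψA₂ : ∀ s x, ‖fderiv ℝ (fderiv ℝ (ψ s)) x‖ ≤ A / R s ^ 2 := fun s x => by
    have hd := fderiv_comp_inv_smul_sub hφD (R s)⁻¹ s
    have hdd : DifferentiableAt ℝ (fun x => fderiv ℝ φ ((R s)⁻¹ • (x - s))) x :=
      (hφD _).comp x ((differentiableAt_id.sub_const s).fun_const_smul _)
    rw [hD1, fderiv_fun_const_smul hdd, hd, sq, ← div_div]
    beta_reduce
    exact norm_inv_smul_le (E := EuclideanSpace ℝ (Fin d) →L[ℝ] EuclideanSpace ℝ (Fin d) →L[ℝ] ℝ)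
      (hR0 s) (norm_inv_smul_le
        (E := EuclideanSpace ℝ (Fin d) →L[ℝ] EuclideanSpace ℝ (Fin d) →L[ℝ] ℝ) (hR0 s) (hφA₂ _))
  have hfin : ∀ x, ∃ T : Finset S, ∀ᶠ y in nhds x, ∀ i ∉ T, ψ i y = 0 := fun x => by
    have h := hSfin _ (isCompact_closedBall x (R x + 2))
    have h' : {i : S | (i : EuclideanSpace ℝ (Fin d)) ∈ closedBall x (R x + 2)}.Finite :=
      Set.Finite.of_finite_image (h.subset (by rintro _ ⟨i, hi, rfl⟩; exact ⟨i.2, hi⟩))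
        Subtype.val_injective.injOn
    refine ⟨h'.toFinset, ?_⟩
    filter_upwards [ball_mem_nhds x one_pos] with y hy i hi
    refine hψout _ _ fun hyi => hi ?_
    rw [Set.Finite.mem_toFinset, Set.mem_ofPred_eq, mem_closedBall]
    rw [mem_ball] at hy
    rw [mem_closedBall] at hyi
    have h1 := hRd i y
    have h2 := hRd y x
    have h3 := dist_triangle (i : EuclideanSpace ℝ (Fin d)) y x
    rw [dist_comm (i : EuclideanSpace ℝ (Fin d)) y] at h1 h3
    linarith
  have hmult' : ∀ x, {i : S | x ∈ closedBall (i : EuclideanSpace ℝ (Fin d)) (R i / 2)}.encard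
      ≤ (M : ℕ∞) := fun x => by
    refine le_trans ?_ (hmult x)
    rw [← Subtype.val_injective.encard_image]
    exact Set.encard_le_encard (by rintro _ ⟨i, hi, rfl⟩; exact ⟨i.2, hi⟩)
  obtain ⟨hFC, hFb⟩ := locallyFinite_tsum_bounds (u := fun (i : S) => ψ i) (fun i => hψC i)
    (K := fun i : S => closedBall (i : EuclideanSpace ℝ (Fin d)) (R i / 2))
    (fun _ => isClosed_closedBall) (fun i => hψout i) hfin hmult'
  set F : EuclideanSpace ℝ (Fin d) → ℝ := fun x => ∑' i : S, ψ i x with hF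
  have hsum : ∀ x, Summable fun i : S => ψ i x := fun x => by
    obtain ⟨T, hT⟩ := hfin x
    exact summable_of_ne_finset_zero hT.self_of_nhds
  have hle : ∀ s ∈ S, ∀ x, ψ s x ≤ F x := fun s hs x =>
    (hsum x).le_tsum ⟨s, hs⟩ fun j _ => hφ0 _
  have hF1 : ∀ x, 1 ≤ F x := fun x => by
    obtain ⟨s, hs, hx⟩ := hcov x
    rw [← hψin s x hx]
    exact hle s hs x
  have hF0 : ∀ x, 0 < F x := fun x => one_pos.trans_le (hF1 x)
  have hf01 : ∀ s ∈ S, ∀ x, ψ s x / F x ∈ Set.Icc (0 : ℝ) 1 := fun s hs x =>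
    ⟨div_nonneg (hφ0 _) (hF0 x).le, (div_le_one (hF0 x)).2 (hle s hs x)⟩
  have hcmp : ∀ s t x, x ∈ closedBall s (R s / 2) → x ∈ closedBall t (R t / 2) →
      R s ≤ 3 * R t := fun s t x hs ht => by
    rw [mem_closedBall] at hs ht
    have h1 := hRd s x
    have h2 := hRd x t
    rw [dist_comm s x] at h1
    linarith
  have hbd : ∀ x s, x ∈ closedBall s (R s / 2) → ‖F x‖ ≤ M * 1 ∧
      ‖fderiv ℝ F x‖ ≤ M * (3 * A / R s) ∧ ‖fderiv ℝ (fderiv ℝ F) x‖ ≤ M * (9 * A / R s ^ 2) := by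
    intro x s hs
    have hs0 := hR0 s
    refine hFb x _ _ _ zero_le_one (by positivity) (by positivity) ?_ ?_ ?_
    · intro i _
      rw [Real.norm_of_nonneg (hφ0 _)]
      exact hφ1 _
    · intro i hi
      have hi0 := hR0 i
      refine (hψA₁ _ _).trans ?_
      rw [div_le_div_iff₀ hi0 hs0]
      nlinarith [hcmp s i x hs hi]
    · intro i hi
      have hi0 := hR0 i
      refine (hψA₂ _ _).trans ?_
      rw [div_le_div_iff₀ (by positivity) (by positivity)]
      have := pow_le_pow_left₀ hs0.le (hcmp s i x hs hi) 2
      nlinarith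
  have hFM : ∀ x, F x ≤ M + 1 := fun x => by
    obtain ⟨s, -, hx⟩ := hcov x
    have h := (hbd x s (closedBall_subset_closedBall (by linarith [hR0 s]) hx)).1
    rw [Real.norm_of_nonneg (hF0 x).le] at h
    linarith
  have hfout : ∀ s, ∀ x ∉ closedBall s (R s / 2), ψ s x / F x = 0 := fun s x hx => by
    rw [hψout s x hx, zero_div]
  have hfout₁ : ∀ s, ∀ x ∉ closedBall s (R s / 2), fderiv ℝ (fun x => ψ s x / F x) x = 0 :=
    fun s x hx => fderiv_eq_zero_of_notMem_of_isClosed isClosed_closedBall (hfout s) hx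
  have hfC : ∀ s, ContDiff ℝ 2 fun x => ψ s x / F x := fun s =>
    (hψC s).div hFC fun x => (hF0 x).ne'
  have hder : ∀ s ∈ S, ∀ x, ‖fderiv ℝ (fun x => ψ s x / F x) x‖ ≤ C₁ / R s ∧
      ‖fderiv ℝ (fderiv ℝ (fun x => ψ s x / F x)) x‖ ≤ C₂ / R s ^ 2 := by
    intro s hs x
    have hs0 := hR0 s
    by_cases hx : x ∈ closedBall s (R s / 2)
    · obtain ⟨-, b₁, b₂⟩ := hbd x s hx
      obtain ⟨h₁, h₂⟩ := norm_fderiv_div_le (hψC s) hFC hF1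
        (abs_le.2 ⟨by linarith [(hf01 s hs x).1], (hf01 s hs x).2⟩)
        (hψA₁ s x) (hψA₂ s x) b₁ b₂
      refine ⟨h₁.trans_eq ?_, h₂.trans_eq ?_⟩
      · rw [hC₁]; field_simp
      · rw [hC₂]; field_simp
    · rw [hfout₁ s x hx, fderiv_eq_zero_of_notMem_of_isClosed isClosed_closedBall (hfout₁ s) hx]
      exact ⟨norm_zero.trans_le (by positivity),
        (norm_zero (E := EuclideanSpace ℝ (Fin d) →L[ℝ] EuclideanSpace ℝ (Fin d) →L[ℝ] ℝ)).trans_le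
          (by positivity)⟩
  refine ⟨fun s x => ψ s x / F x, fun s _ => hfC s, hf01, fun s _ => hfout s, ?_, ?_, ?_, ?_⟩
  · intro x
    rw [tsum_div_const]
    exact div_self (hF0 x).ne'
  · intro s _
    have hs0 := hR0 s
    have hint : ∀ g : EuclideanSpace ℝ (Fin d) → ℝ, Continuous g →
        (∀ x ∉ closedBall s (R s / 2), g x = 0) → Integrable g := fun g hg h =>
      hg.integrable_of_hasCompactSupport
        (HasCompactSupport.intro (isCompact_closedBall s (R s / 2)) fun {x} hx => h x hx)
    have hψI : ∫ x, ψ s x = R s ^ d * ∫ x, φ x := by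
      rw [integral_sub_right_eq_self (fun x => φ ((R s)⁻¹ • x)) s,
        Measure.integral_comp_inv_smul_of_nonneg _ _ hs0.le, finrank_euclideanSpace_fin,
        smul_eq_mul]
    calc (∫ x, φ x) / (M + 1) * R s ^ d = ∫ x, ψ s x / (M + 1) := by
          rw [integral_div, hψI]; ring
      _ ≤ ∫ x, ψ s x / F x := by
          refine integral_mono ((hint _ (hψC s).continuous (hψout s)).div_const _)
            (hint _ (hfC s).continuous (hfout s)) fun x => ?_
          exact div_le_div_of_nonneg_left (hφ0 _) (hF0 x) (hFM x)
  · intro s hs x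
    exact (hder s hs x).1.trans
      (div_le_div_of_nonneg_right (by linarith) (hR0 s).le)
  · intro s hs x
    exact (hder s hs x).2.trans
      (div_le_div_of_nonneg_right (by linarith) (pow_pos (hR0 s) 2).le)
end

section
/- Let R : ℝ^d → (0,∞) be 1-Lipschitz with associated special metric ρ, and let U ⊂ ℝ^d be a closed set. Then there exist a C² function f : ℝ^d → [0,1] and a constant C (depending only on d) such that f = 1 on U, f = 0 outside U_{+4} (the closed 4-neighborhood of U in the metric ρ), and ∫ (R·|∇f| + R²·|∇²f|) dm ≤ C · ∫_{U_{+4} \ U} f dm. -/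
open MeasureTheory

/-- The special metric associated to a positive 1-Lipschitz function `R`:
`ρ(x,y) = inf_γ ∫_γ |dz| / R(z)`, the infimum running over (piecewise) C¹ curves
from `x` to `y`, parametrized over `[0,1]`. -/
noncomputable def specialDist {d : ℕ} (R : EuclideanSpace ℝ (Fin d) → ℝ)
    (x y : EuclideanSpace ℝ (Fin d)) : ℝ :=
  sInf { L | ∃ γ γ' : ℝ → EuclideanSpace ℝ (Fin d),
    (∀ t ∈ Set.Icc (0:ℝ) 1, HasDerivAt γ (γ' t) t) ∧
    ContinuousOn γ' (Set.Icc 0 1) ∧ γ 0 = x ∧ γ 1 = y ∧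
    L = ∫ t in (0:ℝ)..1, ‖γ' t‖ / R (γ t) }

/-- The closed `r`-neighborhood of `U` with respect to the special metric. -/
def nbhd {d : ℕ} (R : EuclideanSpace ℝ (Fin d) → ℝ)
    (U : Set (EuclideanSpace ℝ (Fin d))) (r : ℝ) : Set (EuclideanSpace ℝ (Fin d)) :=
  { y | ∃ x ∈ U, specialDist R x y ≤ r }

section Separation

/-- Every set contains a maximal subset that is pairwise separated for a given relation. -/
theorem exists_maximal_pairwise_subset {α : Type*} (U : Set α) (r : α → α → Prop) :
    ∃ S ⊆ U, S.Pairwise r ∧ ∀ u ∈ U, u ∉ S → ∃ s ∈ S, ¬ (r u s ∧ r s u) := by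
  obtain ⟨S, hS⟩ := zorn_subset {s : Set α | s ⊆ U ∧ s.Pairwise r} (by
    intro c hc hchain
    refine ⟨⋃₀ c, ⟨Set.sUnion_subset fun s hs => (hc hs).1, ?_⟩,
      fun s hs => Set.subset_sUnion_of_mem hs⟩
    exact (Set.pairwise_sUnion hchain.directedOn).2 fun s hs => (hc hs).2)
  refine ⟨S, hS.prop.1, hS.prop.2, fun u hu huS => ?_⟩
  by_contra! h
  have hins : insert u S ⊆ U ∧ (insert u S).Pairwise r :=
    ⟨Set.insert_subset hu hS.prop.1,
      (Set.pairwise_insert_of_notMem huS).2 ⟨hS.prop.2, fun s hs => h s hs⟩⟩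
  exact huS (hS.le_of_ge hins (Set.subset_insert u S) (Set.mem_insert u S))

/-- In a finite-dimensional space, the cardinality of a `δ`-separated subset of the unit ball is
bounded in terms of `δ`. -/
theorem exists_ncard_le_of_separated (E : Type*) [NormedAddCommGroup E] [NormedSpace ℝ E]
    [FiniteDimensional ℝ E] {δ : ℝ} (hδ : 0 < δ) :
    ∃ N : ℕ, ∀ J : Set E, (∀ a ∈ J, ‖a‖ ≤ 1) → (J.Pairwise fun a b => δ ≤ ‖a - b‖) →
      J.Finite ∧ J.ncard ≤ N := by
  have : ProperSpace E := FiniteDimensional.proper ℝ E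
  obtain ⟨t, -, htfin, ht⟩ :=
    (isCompact_closedBall (0 : E) 1).finite_cover_balls (half_pos hδ)
  refine ⟨t.ncard, fun J hJ hsep => ?_⟩
  have h : ∀ a : E, ∃ b : E, a ∈ J → b ∈ t ∧ dist a b < δ / 2 := by
    intro a
    by_cases ha : a ∈ J
    · have := ht (mem_closedBall_zero_iff.2 (hJ a ha))
      simp only [Set.mem_iUnion, Metric.mem_ball, exists_prop] at this
      obtain ⟨b, hb⟩ := this
      exact ⟨b, fun _ => hb⟩
    · exact ⟨0, fun h => absurd h ha⟩
  choose g hg using h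
  have hinj : Set.InjOn g J := by
    intro a ha b hb hab
    by_contra hne
    have h1 := hsep ha hb hne
    have h2 := (hg a ha).2
    have h3 := (hg b hb).2
    rw [← hab] at h3
    have := dist_triangle_right a b (g a)
    rw [dist_eq_norm] at this
    linarith
  have hmaps : Set.MapsTo g J t := fun a ha => (hg a ha).1
  exact ⟨Set.Finite.of_injOn hmaps hinj htfin, Set.ncard_le_ncard_of_injOn g hmaps hinj htfin⟩

end Separation

section Lipschitz

variable {E : Type*} [NormedAddCommGroup E] {R : E → ℝ}

theorem LipschitzWith.le_add_norm_sub (hR : LipschitzWith 1 R) (x y : E) :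
    R x ≤ R y + ‖x - y‖ := by
  have := hR.dist_le_mul x y
  rw [Real.dist_eq, dist_eq_norm, NNReal.coe_one, one_mul] at this
  linarith [le_abs_self (R x - R y)]

/-- A net adapted to `R`: a subset `S` of `U`, separated at scale `R`, such that `U` is covered by
the balls `B(s, R s / 15)` with `s ∈ S`. -/
theorem exists_net (hR : LipschitzWith 1 R) (hpos : ∀ x, 0 < R x) (U : Set E) :
    ∃ S ⊆ U, (S.Pairwise fun s t => R s / 16 ≤ ‖s - t‖) ∧
      ∀ u ∈ U, ∃ s ∈ S, ‖u - s‖ ≤ R s / 15 := by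
  obtain ⟨S, hSU, hS, hmax⟩ := exists_maximal_pairwise_subset U fun s t => R s / 16 ≤ ‖s - t‖
  refine ⟨S, hSU, hS, fun u hu => ?_⟩
  by_cases huS : u ∈ S
  · exact ⟨u, huS, by have := hpos u; simp; positivity⟩
  obtain ⟨s, hs, h⟩ := hmax u hu huS
  refine ⟨s, hs, ?_⟩
  have h1 := hR.le_add_norm_sub u s
  rw [norm_sub_rev s u] at h
  rcases not_and_or.1 h with h | h <;> push Not at h <;> linarith [norm_nonneg (u - s)]

end Lipschitz

theorem specialDist_le {d : ℕ} {R : EuclideanSpace ℝ (Fin d) → ℝ} (hR : LipschitzWith 1 R)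
    (hpos : ∀ x, 0 < R x) {x y : EuclideanSpace ℝ (Fin d)} (h : ‖y - x‖ ≤ R x / 2) :
    specialDist R x y ≤ 1 := by
  have hle : ∀ t ∈ Set.uIoc (0 : ℝ) 1, ‖‖y - x‖ / R (x + t • (y - x))‖ ≤ 1 := by
    intro t ht
    rw [Set.uIoc_of_le zero_le_one] at ht
    have h1 := hR.le_add_norm_sub x (x + t • (y - x))
    have h2 : ‖x - (x + t • (y - x))‖ ≤ ‖y - x‖ := by
      rw [sub_add_cancel_left, norm_neg, norm_smul, Real.norm_of_nonneg ht.1.le]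
      exact mul_le_of_le_one_left (norm_nonneg _) ht.2
    rw [Real.norm_of_nonneg (div_nonneg (norm_nonneg _) (hpos _).le), div_le_one (hpos _)]
    linarith
  have hint : ∫ t in (0 : ℝ)..1, ‖y - x‖ / R (x + t • (y - x)) ≤ 1 := by
    have := intervalIntegral.norm_integral_le_of_norm_le_const hle
    simp only [sub_zero, abs_one, mul_one] at this
    exact (le_abs_self _).trans this
  unfold specialDist
  refine le_trans (csInf_le ⟨0, ?_⟩ ?_) hint
  · rintro _ ⟨γ, γ', -, -, -, -, rfl⟩
    exact intervalIntegral.integral_nonneg zero_le_one fun t _ =>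
      div_nonneg (norm_nonneg _) (hpos _).le
  · refine ⟨fun t => x + t • (y - x), fun _ => y - x, fun t _ => ?_, continuousOn_const,
      by simp, by simp, rfl⟩
    simpa using ((hasDerivAt_id t).smul_const (y - x)).const_add x

section Measure

variable {E : Type*} [NormedAddCommGroup E] [NormedSpace ℝ E] [FiniteDimensional ℝ E]
  [MeasurableSpace E] [BorelSpace E] {μ : Measure E} [μ.IsAddHaarMeasure] {R : E → ℝ}

/-- If every point `x` of `A` has a ball of radius `R x / 128` near it that is contained in `W`,
then the measure of `A` is controlled by that of `W`. -/
theorem measure_le_of_forall_exists_closedBall_subset (hR : LipschitzWith 1 R)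
    (hpos : ∀ x, 0 < R x) {A W : Set E} (hA : MeasurableSet A)
    (h : ∀ x ∈ A, ∃ y, ‖y - x‖ ≤ R x / 2 ∧ Metric.closedBall y (R x / 128) ⊆ W) :
    μ A ≤ ENNReal.ofReal (672 ^ Module.finrank ℝ E) * μ W := by
  set n := Module.finrank ℝ E
  set v : ENNReal := μ (Metric.ball 0 1)
  have hv0 : v ≠ 0 := (Metric.measure_ball_pos μ _ one_pos).ne'
  have hvt : v ≠ ⊤ := measure_ball_lt_top.ne
  have hRc := hR.continuous
  -- the kernel whose double integral is computed in two ways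
  let D : Set (E × E) := {p | ‖p.2 - p.1‖ ≤ 3 / 4 * R p.1}
  have hD : MeasurableSet D := (isClosed_le (by fun_prop) (by fun_prop)).measurableSet
  let k : E → E → ENNReal := fun x y =>
    D.indicator (fun p => ENNReal.ofReal ((128 / R p.1) ^ n)) (x, y)
  have hk : Measurable (Function.uncurry k) := by
    refine Measurable.indicator ?_ hD
    have : Continuous fun p : E × E => (128 / R p.1) ^ n :=
      (continuous_const.div (hRc.comp continuous_fst) fun p => (hpos _).ne').pow n
    exact this.measurable.ennreal_ofReal
  have hlow : ∀ x ∈ A, v ≤ ∫⁻ y in W, k x y ∂μ := by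
    intro x hx
    obtain ⟨y, hyx, hyW⟩ := h x hx
    have hx0 := hpos x
    have hsub : ∀ z ∈ Metric.closedBall y (R x / 128), (x, z) ∈ D := by
      intro z hz
      rw [mem_closedBall_iff_norm] at hz
      have := norm_sub_le_norm_sub_add_norm_sub z y x
      change ‖z - x‖ ≤ 3 / 4 * R x
      linarith
    calc v = ENNReal.ofReal ((128 / R x) ^ n) * μ (Metric.closedBall y (R x / 128)) := by
          rw [Measure.addHaar_closedBall μ y (by positivity), ← mul_assoc,
            ← ENNReal.ofReal_mul (by positivity), ← mul_pow]
          have : 128 / R x * (R x / 128) = 1 := by field_simp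
          rw [this, one_pow, ENNReal.ofReal_one, one_mul]
      _ = ∫⁻ z in Metric.closedBall y (R x / 128), ENNReal.ofReal ((128 / R x) ^ n) ∂μ := by
          rw [setLIntegral_const]
      _ = ∫⁻ z in Metric.closedBall y (R x / 128), k x z ∂μ := by
          refine setLIntegral_congr_fun Metric.isClosed_closedBall.measurableSet fun z hz => ?_
          change _ = D.indicator _ (x, z)
          rw [Set.indicator_of_mem (hsub z hz)]
      _ ≤ ∫⁻ z in W, k x z ∂μ := lintegral_mono_set hyW
  have hup : ∀ y, ∫⁻ x in A, k x y ∂μ ≤ ENNReal.ofReal (672 ^ n) * v := by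
    intro y
    have hy0 := hpos y
    calc ∫⁻ x in A, k x y ∂μ ≤ ∫⁻ x, k x y ∂μ := setLIntegral_le_lintegral _ _
      _ ≤ ∫⁻ x, (Metric.closedBall y (3 * R y)).indicator
            (fun _ => ENNReal.ofReal ((224 / R y) ^ n)) x ∂μ := by
          refine lintegral_mono fun x => ?_
          by_cases hx : (x, y) ∈ D
          · have hx' : ‖y - x‖ ≤ 3 / 4 * R x := hx
            have h1 := hR.le_add_norm_sub x y
            have h2 := hR.le_add_norm_sub y x
            rw [norm_sub_rev x y] at h1
            have hx0 := hpos x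
            have hmem : x ∈ Metric.closedBall y (3 * R y) := by
              rw [mem_closedBall_iff_norm, norm_sub_rev]
              linarith
            rw [Set.indicator_of_mem hmem]
            change D.indicator _ (x, y) ≤ _
            rw [Set.indicator_of_mem hx]
            refine ENNReal.ofReal_le_ofReal (pow_le_pow_left₀ (by positivity) ?_ _)
            change 128 / R x ≤ 224 / R y
            rw [div_le_div_iff₀ hx0 hy0]
            linarith
          · change D.indicator _ (x, y) ≤ _
            rw [Set.indicator_of_notMem hx]
            exact bot_le
      _ = ENNReal.ofReal (672 ^ n) * v := by
          rw [lintegral_indicator Metric.isClosed_closedBall.measurableSet, setLIntegral_const,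
            Measure.addHaar_closedBall μ y (by positivity), ← mul_assoc,
            ← ENNReal.ofReal_mul (by positivity), ← mul_pow]
          have : 224 / R y * (3 * R y) = 672 := by field_simp; norm_num
          rw [this]
  have hmain : μ A * v ≤ ENNReal.ofReal (672 ^ n) * μ W * v := by
    calc μ A * v = ∫⁻ _ in A, v ∂μ := by rw [setLIntegral_const, mul_comm]
      _ ≤ ∫⁻ x in A, ∫⁻ y in W, k x y ∂μ ∂μ := setLIntegral_mono' hA hlow
      _ = ∫⁻ y in W, ∫⁻ x in A, k x y ∂μ ∂μ := lintegral_lintegral_swap hk.aemeasurable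
      _ ≤ ∫⁻ _ in W, ENNReal.ofReal (672 ^ n) * v ∂μ := lintegral_mono fun y => hup y
      _ = ENNReal.ofReal (672 ^ n) * μ W * v := by rw [setLIntegral_const]; ring
  exact (ENNReal.mul_le_mul_iff_left hv0 hvt).1 hmain

end Measure

section Cutoff

set_option maxSynthPendingDepth 3

theorem exists_bound_deriv_smoothTransition :
    ∃ X, ∀ t, ‖deriv Real.smoothTransition t‖ ≤ X ∧ ‖deriv (deriv Real.smoothTransition) t‖ ≤ X := by
  have hdiff : ContDiff ℝ 2 Real.smoothTransition := Real.smoothTransition.contDiff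
  have hc : HasCompactSupport (deriv Real.smoothTransition) := by
    refine HasCompactSupport.intro (isCompact_Icc (a := (0 : ℝ)) (b := 1)) fun t ht => ?_
    rw [Set.mem_Icc, not_and_or, not_le, not_le] at ht
    rcases ht with ht | ht
    · have : Real.smoothTransition =ᶠ[nhds t] fun _ => 0 :=
        Filter.eventually_of_mem (Iio_mem_nhds ht) fun u hu =>
          Real.smoothTransition.zero_of_nonpos (le_of_lt hu)
      rw [this.deriv_eq, deriv_const]
    · have : Real.smoothTransition =ᶠ[nhds t] fun _ => 1 :=
        Filter.eventually_of_mem (Ioi_mem_nhds ht) fun u hu =>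
          Real.smoothTransition.one_of_one_le (le_of_lt hu)
      rw [this.deriv_eq, deriv_const]
  have h1 : ContDiff ℝ 1 (deriv Real.smoothTransition) :=
    (contDiff_succ_iff_deriv (n := 1)).1 hdiff |>.2.2
  obtain ⟨X₁, hX₁⟩ := hc.exists_bound_of_continuous h1.continuous
  obtain ⟨X₂, hX₂⟩ := hc.deriv.exists_bound_of_continuous (h1.continuous_deriv le_rfl)
  exact ⟨max X₁ X₂, fun t => ⟨(hX₁ t).trans (le_max_left _ _), (hX₂ t).trans (le_max_right _ _)⟩⟩

variable {E : Type*} [NormedAddCommGroup E]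

section Calculus

variable [NormedSpace ℝ E]

theorem fderiv_comp_smul_sub (ψ : E → ℝ) (c : ℝ) (s : E) :
    fderiv ℝ (fun x => ψ (c • (x - s))) = fun x => c • fderiv ℝ ψ (c • (x - s)) := by
  ext1 x
  rw [fderiv_comp_sub (f := fun x => ψ (c • x)), fderiv_comp_smul]

theorem fderiv_fderiv_comp_smul_sub {ψ : E → ℝ} (hψ : ContDiff ℝ 2 ψ) (c : ℝ) (s x : E) :
    fderiv ℝ (fderiv ℝ fun x => ψ (c • (x - s))) x =
      c ^ 2 • fderiv ℝ (fderiv ℝ ψ) (c • (x - s)) := by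
  have h1 : Differentiable ℝ (fderiv ℝ ψ) :=
    (hψ.fderiv_right (m := 1) le_rfl).differentiable one_ne_zero
  have h2 : DifferentiableAt ℝ (fun x => fderiv ℝ ψ (c • (x - s))) x := by fun_prop
  rw [fderiv_comp_smul_sub]
  refine (h2.hasFDerivAt.const_smul c).fderiv.trans ?_
  rw [fderiv_comp_sub (f := fun x => fderiv ℝ ψ (c • x)), fderiv_comp_smul, smul_smul, sq]

theorem norm_fderiv_comp_le {χ : ℝ → ℝ} {F : E → ℝ} (hχ : ContDiff ℝ 2 χ) (hF : ContDiff ℝ 2 F)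
    {X : ℝ} (hX : ∀ t, ‖deriv χ t‖ ≤ X ∧ ‖deriv (deriv χ) t‖ ≤ X) (x : E) :
    ‖fderiv ℝ (χ ∘ F) x‖ ≤ X * ‖fderiv ℝ F x‖ ∧
      ‖fderiv ℝ (fderiv ℝ (χ ∘ F)) x‖ ≤
        X * ‖fderiv ℝ F x‖ ^ 2 + X * ‖fderiv ℝ (fderiv ℝ F) x‖ := by
  have hχ1 : ContDiff ℝ 1 (deriv χ) := ((contDiff_succ_iff_deriv (n := 1)).1 hχ).2.2
  have hF1 : Differentiable ℝ (fderiv ℝ F) :=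
    (hF.fderiv_right (m := 1) le_rfl).differentiable one_ne_zero
  have hFd : Differentiable ℝ F := hF.differentiable two_ne_zero
  have heq : fderiv ℝ (χ ∘ F) = fun x => deriv χ (F x) • fderiv ℝ F x := by
    ext1 x
    exact ((hχ.differentiable two_ne_zero (F x)).hasDerivAt.comp_hasFDerivAt x
      (hFd x).hasFDerivAt).fderiv
  have h2 : HasFDerivAt (fun x => deriv χ (F x)) (deriv (deriv χ) (F x) • fderiv ℝ F x) x :=
    (hχ1.differentiable one_ne_zero (F x)).hasDerivAt.comp_hasFDerivAt x (hFd x).hasFDerivAt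
  have h3 : fderiv ℝ (fun x => deriv χ (F x) • fderiv ℝ F x) x = _ :=
    (h2.smul (hF1 x).hasFDerivAt).fderiv
  rw [heq, h3]
  refine ⟨?_, (norm_add_le (_ : E →L[ℝ] E →L[ℝ] ℝ) _).trans ?_⟩
  · rw [norm_smul]
    exact mul_le_mul_of_nonneg_right (hX _).1 (norm_nonneg _)
  · rw [norm_smul, ContinuousLinearMap.norm_smulRight_apply, norm_smul, add_comm, sq, ← mul_assoc]
    gcongr
    exacts [(hX _).2, (hX _).1]

end Calculus

theorem LipschitzWith.le_half_of_lt_third {R : E → ℝ} (hR : LipschitzWith 1 R) {x s : E}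
    (h : ‖x - s‖ < R s / 3) : ‖x - s‖ ≤ R x / 2 ∧ R x ≤ 4 / 3 * R s ∧ R s ≤ 3 / 2 * R x := by
  have h1 := hR.le_add_norm_sub x s
  have h2 := hR.le_add_norm_sub s x
  rw [norm_sub_rev s x] at h2
  refine ⟨?_, ?_, ?_⟩ <;> linarith

variable [NormedSpace ℝ E] [FiniteDimensional ℝ E]

/-- The number of points of a separated set that see a given point is bounded. -/
theorem exists_ncard_le_of_net (E : Type*) [NormedAddCommGroup E] [NormedSpace ℝ E]
    [FiniteDimensional ℝ E] :
    ∃ N : ℕ, ∀ R : E → ℝ, LipschitzWith 1 R → (∀ x, 0 < R x) → ∀ S : Set E,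
      (S.Pairwise fun s t => R s / 16 ≤ ‖s - t‖) → ∀ x,
        {s ∈ S | ‖x - s‖ < R s / 3}.Finite ∧ {s ∈ S | ‖x - s‖ < R s / 3}.ncard ≤ N := by
  obtain ⟨N, hN⟩ := exists_ncard_le_of_separated E (δ := 3 / 64) (by norm_num)
  refine ⟨N, fun R hR hpos S hS x => ?_⟩
  have hx := hpos x
  set J := {s ∈ S | ‖x - s‖ < R s / 3}
  let g : E → E := fun s => (R x)⁻¹ • (s - x)
  have hg : Function.Injective g := fun s t hst => by
    have := smul_right_injective E (inv_ne_zero hx.ne') hst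
    exact sub_left_injective this
  have key := hN (g '' J) (by
    rintro _ ⟨s, ⟨-, hs⟩, rfl⟩
    have := (hR.le_half_of_lt_third hs).1
    rw [norm_smul, norm_inv, Real.norm_of_nonneg hx.le, norm_sub_rev, inv_mul_le_iff₀ hx]
    linarith) (by
    rintro _ ⟨s, ⟨hsS, hs⟩, rfl⟩ _ ⟨t, ⟨htS, -⟩, rfl⟩ hne
    have h1 := hS hsS htS fun h => hne (by rw [h])
    have h2 := (hR.le_half_of_lt_third hs).2.1
    have : g s - g t = (R x)⁻¹ • (s - t) := by simp only [g, ← smul_sub, sub_sub_sub_cancel_right]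
    rw [this, norm_smul, norm_inv, Real.norm_of_nonneg hx.le, le_inv_mul_iff₀ hx]
    linarith)
  rw [Set.ncard_image_of_injective _ hg] at key
  exact ⟨Set.Finite.of_finite_image key.1 hg.injOn, key.2⟩

set_option maxHeartbeats 400000 in
/-- A smooth cutoff function adapted to the scale `R`: it equals `1` near `U`, is supported near
`U`, and its first two derivatives are controlled by the corresponding powers of `R⁻¹`. -/
theorem exists_cutoff (E : Type*) [NormedAddCommGroup E] [NormedSpace ℝ E] [FiniteDimensional ℝ E]
    [HasContDiffBump E] :
    ∃ K : ℝ, 0 < K ∧ ∀ R : E → ℝ, LipschitzWith 1 R → (∀ x, 0 < R x) → ∀ U : Set E,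
      ∃ f : E → ℝ, ContDiff ℝ 2 f ∧ (∀ x, f x ∈ Set.Icc (0 : ℝ) 1) ∧
        (∀ x, ∀ u ∈ U, ‖x - u‖ < R x / 16 → f x = 1) ∧
        (∀ x ∈ tsupport f, ∃ u ∈ U, ‖x - u‖ < R u / 3) ∧
        ∀ x, R x * ‖fderiv ℝ f x‖ + R x ^ 2 * ‖fderiv ℝ (fderiv ℝ f) x‖ ≤ K := by
  obtain ⟨N, hN⟩ := exists_ncard_le_of_net E
  obtain ⟨X, hX⟩ := exists_bound_deriv_smoothTransition
  let ψ : ContDiffBump (0 : E) := ⟨1 / 5, 1 / 4, by norm_num, by norm_num⟩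
  have hψ : ContDiff ℝ 2 ψ := ψ.contDiff
  have hψ1 : ContDiff ℝ 1 (fderiv ℝ ψ) := hψ.fderiv_right le_rfl
  obtain ⟨K₁, hK₁⟩ :=
    (ψ.hasCompactSupport.fderiv ℝ).exists_bound_of_continuous hψ1.continuous
  obtain ⟨K₂, hK₂⟩ := ((ψ.hasCompactSupport.fderiv ℝ).fderiv ℝ).exists_bound_of_continuous
    (hψ1.continuous_fderiv one_ne_zero)
  have hK₁0 : 0 ≤ K₁ := (norm_nonneg _).trans (hK₁ 0)
  have hK₂0 : 0 ≤ K₂ := (norm_nonneg _).trans (hK₂ 0)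
  have hX0 : 0 ≤ X := (norm_nonneg _).trans (hX 0).1
  set A : ℝ := N * (4 / 3 * K₁)
  set B : ℝ := N * ((4 / 3) ^ 2 * K₂)
  have hA0 : 0 ≤ A := by positivity
  have hB0 : 0 ≤ B := by positivity
  refine ⟨X * A + (X * A ^ 2 + X * B) + 1, by positivity, fun R hR hpos U => ?_⟩
  obtain ⟨S, hSU, hS, hcov⟩ := exists_net hR hpos U
  let b : E → E → ℝ := fun s x => ψ ((R s)⁻¹ • (x - s))
  have hb_diff : ∀ s, ContDiff ℝ 2 (b s) := fun s =>
    hψ.comp (contDiff_const.smul (contDiff_id.sub contDiff_const))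
  have hnorm : ∀ s x, ‖(R s)⁻¹ • (x - s)‖ = ‖x - s‖ / R s := fun s x => by
    rw [norm_smul, norm_inv, Real.norm_of_nonneg (hpos s).le, inv_mul_eq_div]
  have hb_supp : ∀ s x, b s x ≠ 0 → ‖x - s‖ < R s / 4 := by
    intro s x h
    have : (R s)⁻¹ • (x - s) ∈ Function.support ψ := h
    rw [ψ.support_eq, mem_ball_zero_iff, hnorm, div_lt_iff₀ (hpos s)] at this
    change _ < 1 / 4 * _ at this
    linarith
  have hb_one : ∀ s x, ‖x - s‖ ≤ R s / 5 → b s x = 1 := by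
    intro s x h
    refine ψ.one_of_mem_closedBall ?_
    rw [mem_closedBall_zero_iff, hnorm, div_le_iff₀ (hpos s)]
    change _ ≤ 1 / 5 * _
    linarith
  have hmove : ∀ x z s, z ∈ Metric.ball x (R x / 20) → b s z ≠ 0 → ‖x - s‖ < R s / 3 := by
    intro x z s hz h
    rw [mem_ball_iff_norm, norm_sub_rev] at hz
    have h1 := hb_supp s z h
    have h2 := norm_sub_le_norm_sub_add_norm_sub x z s
    have h3 := hR.le_add_norm_sub x s
    have h4 := hpos s
    linarith
  let F : E → ℝ := fun x => ∑ᶠ s ∈ S, b s x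
  have hF_nonneg : ∀ x, 0 ≤ F x := fun x =>
    finsum_nonneg fun s => finsum_nonneg fun _ => ψ.nonneg
  let J : E → Finset E := fun x => (hN R hR hpos S hS x).1.toFinset
  have hJ : ∀ x s, s ∈ J x ↔ s ∈ S ∧ ‖x - s‖ < R s / 3 := fun x s => by simp [J]
  have hJcard : ∀ x, (J x).card ≤ N := fun x => by
    rw [← Set.ncard_eq_toFinset_card _ (hN R hR hpos S hS x).1]; exact (hN R hR hpos S hS x).2
  have hF_local : ∀ x, F =ᶠ[nhds x] fun z => ∑ s ∈ J x, b s z := by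
    intro x
    have : 0 < R x / 20 := by have := hpos x; positivity
    filter_upwards [Metric.ball_mem_nhds x this] with z hz
    refine finsum_mem_eq_sum_of_inter_support_eq _ (Set.ext fun s => ?_)
    simp only [Set.mem_inter_iff, Function.mem_support, Finset.mem_coe, hJ]
    exact ⟨fun h => ⟨⟨h.1, hmove x z s hz h.2⟩, h.2⟩, fun h => ⟨h.1.1, h.2⟩⟩
  have hF_diff : ContDiff ℝ 2 F := contDiff_iff_contDiffAt.2 fun x =>
    (ContDiff.sum fun s _ => hb_diff s).contDiffAt.congr_of_eventuallyEq (hF_local x)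
  have hb1_diff : ∀ s, Differentiable ℝ (fderiv ℝ (b s)) := fun s =>
    ((hb_diff s).fderiv_right (m := 1) le_rfl).differentiable one_ne_zero
  have hF1_local : ∀ x, fderiv ℝ F =ᶠ[nhds x] fun z => ∑ s ∈ J x, fderiv ℝ (b s) z := fun x => by
    filter_upwards [(hF_local x).fderiv (𝕜 := ℝ)] with z hz
    rw [hz]
    exact fderiv_fun_sum fun s _ => (hb_diff s).differentiable two_ne_zero z
  have hscale : ∀ x s, ‖x - s‖ < R s / 3 → (R s)⁻¹ ≤ 4 / 3 * (R x)⁻¹ := by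
    intro x s h
    have h1 := (hR.le_half_of_lt_third h).2.1
    have := hpos x
    have := hpos s
    rw [← div_eq_mul_inv, inv_eq_one_div, div_le_div_iff₀ (hpos s) (hpos x)]
    linarith
  have hinv : ∀ s, 0 ≤ (R s)⁻¹ := fun s => inv_nonneg.2 (hpos s).le
  have hF1 : ∀ x, ‖fderiv ℝ F x‖ ≤ A * (R x)⁻¹ := by
    intro x
    have hA : A * (R x)⁻¹ = N * (4 / 3 * (R x)⁻¹ * K₁) := by simp only [A]; ring
    have hxi := hinv x
    rw [(hF1_local x).self_of_nhds, hA]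
    calc _ ≤ ∑ s ∈ J x, ‖fderiv ℝ (b s) x‖ := norm_sum_le _ _
      _ ≤ ∑ _s ∈ J x, 4 / 3 * (R x)⁻¹ * K₁ := by
          refine Finset.sum_le_sum fun s hs => ?_
          simp only [b, fderiv_comp_smul_sub]
          rw [norm_smul, Real.norm_of_nonneg (hinv s)]
          exact mul_le_mul (hscale x s ((hJ x s).1 hs).2) (hK₁ _) (norm_nonneg _) (by positivity)
      _ ≤ N * (4 / 3 * (R x)⁻¹ * K₁) := by
          rw [Finset.sum_const, nsmul_eq_mul]
          gcongr
          exact hJcard x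
  have hF2 : ∀ x, ‖fderiv ℝ (fderiv ℝ F) x‖ ≤ B * (R x)⁻¹ ^ 2 := by
    intro x
    have hB : B * (R x)⁻¹ ^ 2 = N * ((4 / 3 * (R x)⁻¹) ^ 2 * K₂) := by simp only [B]; ring
    have hxi := hinv x
    rw [(hF1_local x).fderiv_eq, hB, fderiv_fun_sum fun s _ => hb1_diff s x]
    calc _ ≤ ∑ s ∈ J x, ‖fderiv ℝ (fderiv ℝ (b s)) x‖ := norm_sum_le _ _
      _ ≤ ∑ _s ∈ J x, (4 / 3 * (R x)⁻¹) ^ 2 * K₂ := by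
          refine Finset.sum_le_sum fun s hs => ?_
          simp only [b, fderiv_fderiv_comp_smul_sub hψ]
          rw [norm_smul, Real.norm_of_nonneg (sq_nonneg _)]
          exact mul_le_mul (pow_le_pow_left₀ (hinv s) (hscale x s ((hJ x s).1 hs).2) 2) (hK₂ _)
            (norm_nonneg _) (by positivity)
      _ ≤ N * ((4 / 3 * (R x)⁻¹) ^ 2 * K₂) := by
          rw [Finset.sum_const, nsmul_eq_mul]
          gcongr
          exact hJcard x
  refine ⟨Real.smoothTransition ∘ F, Real.smoothTransition.contDiff.comp hF_diff, fun x =>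
    ⟨Real.smoothTransition.nonneg _, Real.smoothTransition.le_one _⟩, fun x u hu hxu => ?_,
    fun x hx => ?_, fun x => ?_⟩
  · obtain ⟨s, hs, hus⟩ := hcov u hu
    have h1 := norm_sub_le_norm_sub_add_norm_sub x u s
    have h2 := hR.le_add_norm_sub x s
    have h3 := hpos s
    have hxs : ‖x - s‖ ≤ R s / 5 := by linarith
    refine Real.smoothTransition.one_of_one_le ?_
    rw [(hF_local x).self_of_nhds, ← hb_one s x hxs]
    exact Finset.single_le_sum (f := fun s => b s x) (fun s _ => ψ.nonneg)
      ((hJ x s).2 ⟨hs, by linarith⟩)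
  · have hball : Metric.ball x (R x / 20) ∈ nhds x :=
      Metric.ball_mem_nhds x (by have := hpos x; positivity)
    obtain ⟨z, hz, hfz⟩ := mem_closure_iff_nhds.1 hx _ hball
    have hFz : F z ≠ 0 := fun h => hfz (by simp [h])
    obtain ⟨s, hs, hbs⟩ := exists_ne_zero_of_finsum_mem_ne_zero hFz
    exact ⟨s, hSU hs, hmove x z s hz hbs⟩
  · obtain ⟨h1, h2⟩ := norm_fderiv_comp_le Real.smoothTransition.contDiff hF_diff hX x
    have hx := hpos x
    have h1' : R x * ‖fderiv ℝ (Real.smoothTransition ∘ F) x‖ ≤ X * A := by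
      calc _ ≤ R x * (X * (A * (R x)⁻¹)) := by gcongr; exact h1.trans (by gcongr; exact hF1 x)
        _ = X * A := by field_simp
    have h2' : R x ^ 2 * ‖fderiv ℝ (fderiv ℝ (Real.smoothTransition ∘ F)) x‖ ≤
        X * A ^ 2 + X * B := by
      calc _ ≤ R x ^ 2 * (X * (A * (R x)⁻¹) ^ 2 + X * (B * (R x)⁻¹ ^ 2)) := by
            gcongr
            refine h2.trans ?_
            gcongr
            exacts [hF1 x, hF2 x]
        _ = X * A ^ 2 + X * B := by field_simp
    linarith

end Cutoff

section Oscillation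

set_option maxSynthPendingDepth 3

/-- A smooth function dominating a given nonnegative sequence. -/
theorem exists_contDiff_forall_floor_le {a : ℕ → ℝ} (ha : ∀ n, 0 ≤ a n) :
    ∃ k : ℝ → ℝ, ContDiff ℝ 1 k ∧ ∀ t, a ⌊t⌋₊ ≤ k t := by
  have hloc : ∀ t : ℝ, ∃ c : ℝ, ∀ᶠ y in nhds t, c ∈ Set.Ici (a ⌊y⌋₊) := fun t =>
    ⟨∑ i ∈ Finset.range (⌊t + 1⌋₊ + 1), a i, by
      filter_upwards [Iio_mem_nhds (lt_add_one t)] with y hy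
      exact Finset.single_le_sum (fun i _ => ha i)
        (Finset.mem_range_succ_iff.2 (Nat.floor_le_floor (le_of_lt hy)))⟩
  obtain ⟨k, hk⟩ := exists_contMDiffMap_forall_mem_convex_of_local_const (n := 1)
    (modelWithCornersSelf ℝ ℝ) (t := fun t : ℝ => Set.Ici (a ⌊t⌋₊)) (fun _ => convex_Ici _) hloc
  exact ⟨k, k.contMDiff.contDiff, hk⟩

variable {E : Type*} [NormedAddCommGroup E] [InnerProductSpace ℝ E]

/-- A function whose gradient grows along the radial direction at a prescribed rate. -/
theorem exists_contDiff_le_norm_fderiv {a : ℕ → ℝ} (ha : ∀ n, 0 ≤ a n) :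
    ∃ K : E → ℝ, ContDiff ℝ 2 K ∧ ∀ x, ‖x‖ * a ⌊‖x‖ ^ 2⌋₊ ≤ ‖fderiv ℝ K x‖ := by
  obtain ⟨k, hk, hak⟩ := exists_contDiff_forall_floor_le ha
  let κ : ℝ → ℝ := fun t => ∫ s in (0 : ℝ)..t, k s
  have hκ : ∀ t, HasDerivAt κ (k t) t := fun t =>
    intervalIntegral.integral_hasDerivAt_right (hk.continuous.intervalIntegrable _ _)
      (hk.continuous.stronglyMeasurableAtFilter _ _) hk.continuous.continuousAt
  have hκ2 : ContDiff ℝ 2 κ := by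
    refine (contDiff_succ_iff_deriv (n := 1)).2 ⟨fun t => (hκ t).differentiableAt, by simp, ?_⟩
    rwa [funext fun t => (hκ t).deriv]
  refine ⟨fun x => κ (‖x‖ ^ 2), hκ2.comp (contDiff_norm_sq ℝ), fun x => ?_⟩
  rcases eq_or_ne x 0 with rfl | hx
  · simp
  have hx0 : 0 < ‖x‖ := norm_pos_iff.2 hx
  have hfd : fderiv ℝ (fun x : E => κ (‖x‖ ^ 2)) x = k (‖x‖ ^ 2) • (2 • innerSL ℝ x) := by
    have hd : HasFDerivAt (fun x : E => ‖x‖ ^ 2) (2 • innerSL ℝ x) x :=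
      (hasStrictFDerivAt_norm_sq x).hasFDerivAt
    exact ((hκ (‖x‖ ^ 2)).comp_hasFDerivAt x hd).fderiv
  have hle := (fderiv ℝ (fun x : E => κ (‖x‖ ^ 2)) x).le_opNorm x
  have hval : (fderiv ℝ (fun x : E => κ (‖x‖ ^ 2)) x) x = k (‖x‖ ^ 2) * (2 * ‖x‖ ^ 2) := by
    rw [hfd]
    simp
  have hk0 := (ha _).trans (hak (‖x‖ ^ 2))
  rw [hval, Real.norm_of_nonneg (by positivity)] at hle
  have h1 : ‖x‖ * k (‖x‖ ^ 2) * ‖x‖ ≤ ‖fderiv ℝ (fun x : E => κ (‖x‖ ^ 2)) x‖ * ‖x‖ := by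
    nlinarith [mul_nonneg hk0 (sq_nonneg ‖x‖)]
  exact (mul_le_mul_of_nonneg_left (hak _) hx0.le).trans (le_of_mul_le_mul_right h1 hx0)

variable [FiniteDimensional ℝ E] [MeasurableSpace E] [BorelSpace E] {μ : Measure E}

theorem exists_phase_not_integrable [IsFiniteMeasureOnCompacts μ] {v : E → ℝ} (hv : Continuous v)
    (hv0 : ∀ x, 0 ≤ v x) (hμ : μ (Function.support v) = ⊤) :
    ∃ K : E → ℝ, ContDiff ℝ 2 K ∧ ¬ Integrable (fun x => v x * ‖fderiv ℝ K x‖) μ := by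
  have : ProperSpace E := FiniteDimensional.proper ℝ E
  let p : E → ℕ := fun x => ⌊‖x‖ ^ 2⌋₊
  have hp : Measurable p := Nat.measurable_floor.comp (by fun_prop)
  let A : ℕ → Set E := fun n => p ⁻¹' {n}
  have hA : ∀ n, MeasurableSet (A n) := fun n => hp (measurableSet_singleton n)
  have hAd : Pairwise (Function.onFun Disjoint A) := fun m n hmn =>
    Disjoint.preimage p (Set.disjoint_singleton.2 hmn)
  let m : ℕ → ENNReal := fun n => ∫⁻ x in A n, ENNReal.ofReal (v x * ‖x‖) ∂μ
  have ha : ∀ n, ∃ a : ℝ, 0 ≤ a ∧ (m n ≠ 0 → 1 ≤ ENNReal.ofReal a * m n) := by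
    intro n
    refine ⟨(m n)⁻¹.toReal + 1, by positivity, fun h => ?_⟩
    rw [ENNReal.ofReal_add ENNReal.toReal_nonneg zero_le_one,
      ENNReal.ofReal_toReal (ENNReal.inv_ne_top.2 h), ENNReal.ofReal_one, add_mul, one_mul]
    rcases eq_or_ne (m n) ⊤ with htop | htop
    · rw [htop]; simp
    · rw [ENNReal.inv_mul_cancel h htop]; exact le_self_add
  choose a ha0 ha using ha
  obtain ⟨K, hK, haK⟩ := exists_contDiff_le_norm_fderiv (E := E) ha0
  refine ⟨K, hK, fun hint => ?_⟩
  have hlt : ∑' n, ∫⁻ x in A n, ‖v x * ‖fderiv ℝ K x‖‖ₑ ∂μ ≠ ⊤ := by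
    rw [← lintegral_iUnion hA hAd]
    exact ((lintegral_mono' Measure.restrict_le_self le_rfl).trans_lt hint.2).ne
  have hle : ∀ n, m n ≠ 0 → 1 ≤ ∫⁻ x in A n, ‖v x * ‖fderiv ℝ K x‖‖ₑ ∂μ := by
    intro n hn
    refine (ha n hn).trans ?_
    rw [← lintegral_const_mul' _ _ ENNReal.ofReal_ne_top]
    refine setLIntegral_mono' (hA n) fun x hx => ?_
    rw [Real.enorm_of_nonneg (mul_nonneg (hv0 x) (norm_nonneg _)), ← ENNReal.ofReal_mul (ha0 n)]
    refine ENNReal.ofReal_le_ofReal ?_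
    have hx' : ⌊‖x‖ ^ 2⌋₊ = n := hx
    have := mul_le_mul_of_nonneg_left (haK x) (hv0 x)
    rw [hx'] at this
    linarith
  obtain ⟨n₀, hn₀⟩ := (ENNReal.finite_const_le_of_tsum_ne_top hlt one_ne_zero).bddAbove
  have hzero : ∀ n, n₀ < n → m n = 0 := fun n hn => by
    by_contra h
    exact absurd (hn₀ (hle n h)) (not_le.2 hn)
  have hnull : μ (⋃ n, {x ∈ A n | n₀ < n ∧ v x * ‖x‖ ≠ 0}) = 0 := by
    refine measure_iUnion_null fun n => ?_
    by_cases hn : n₀ < n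
    · have h := hzero n hn
      have hmeas : Measurable fun x => ENNReal.ofReal (v x * ‖x‖) :=
        (hv.mul continuous_norm).measurable.ennreal_ofReal
      rw [lintegral_eq_zero_iff hmeas, Filter.EventuallyEq, ae_restrict_iff' (hA n), ae_iff] at h
      refine measure_mono_null ?_ h
      rintro x ⟨hxA, -, hx⟩ h'
      have := h' hxA
      simp only [Pi.zero_apply, ENNReal.ofReal_eq_zero] at this
      exact hx (le_antisymm this (mul_nonneg (hv0 x) (norm_nonneg _)))
    · simp [hn]
  have hsub : Function.support v ⊆ Metric.closedBall 0 (n₀ + 1) ∪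
      ⋃ n, {x ∈ A n | n₀ < n ∧ v x * ‖x‖ ≠ 0} := by
    intro x hx
    by_cases hxb : ‖x‖ ≤ n₀ + 1
    · exact Or.inl (mem_closedBall_zero_iff.2 hxb)
    · push Not at hxb
      have hn : (0 : ℝ) ≤ n₀ := Nat.cast_nonneg _
      refine Or.inr (Set.mem_iUnion.2 ⟨p x, rfl, ?_, mul_ne_zero hx (by linarith)⟩)
      refine Nat.lt_of_succ_le (Nat.le_floor ?_)
      push_cast
      nlinarith
  have := (measure_mono hsub).trans (measure_union_le (μ := μ) _ _)
  rw [hμ, hnull, add_zero, top_le_iff] at this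
  exact (isCompact_closedBall (0 : E) _).measure_lt_top.ne this

/-- In an open set of infinite measure lives a function with values in `[0, 1]` that oscillates so
much that its gradient is not integrable against a given positive weight. -/
theorem exists_gradient_not_integrable [IsFiniteMeasureOnCompacts μ] {w : E → ℝ}
    (hw : Continuous w) (hw0 : ∀ x, 0 < w x) {W : Set E} (hW : IsOpen W) (hμ : μ W = ⊤) :
    ∃ g : E → ℝ, ContDiff ℝ 2 g ∧ (∀ x, g x ∈ Set.Icc (0 : ℝ) 1) ∧ Function.support g ⊆ W ∧
      ¬ Integrable (fun x => w x * ‖fderiv ℝ g x‖) μ := by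
  obtain ⟨φ, hφW, hφ, hφ01⟩ := hW.exists_contDiff_support_eq (n := 2)
  replace hφ : ContDiff ℝ 2 φ := hφ
  have hφ01 : ∀ x, φ x ∈ Set.Icc (0 : ℝ) 1 := fun x => hφ01 (Set.mem_range_self x)
  obtain ⟨K, hK, hKint⟩ := exists_phase_not_integrable (μ := μ) (v := fun x => w x * φ x)
    (hw.mul hφ.continuous) (fun x => mul_nonneg (hw0 x).le (hφ01 x).1) (by
      rw [Function.support_mul, hφW, Function.support_eq_univ fun x => (hw0 x).ne', Set.univ_inter,
        hμ])
  by_contra! h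
  have hφd : Differentiable ℝ φ := hφ.differentiable two_ne_zero
  have hKd : Differentiable ℝ K := hK.differentiable two_ne_zero
  have hfam : ∀ {c c' : ℝ → ℝ}, ContDiff ℝ 2 c → (∀ t, HasDerivAt c (c' t) t) →
      (∀ t, c t ∈ Set.Icc (-1 : ℝ) 1) →
      Integrable (fun x => w x * ‖fderiv ℝ (fun x => φ x * ((1 + c (K x)) / 2)) x‖) μ ∧
      ∀ x, φ x * |c' (K x)| * ‖fderiv ℝ K x‖ ≤
        2 * ‖fderiv ℝ (fun x => φ x * ((1 + c (K x)) / 2)) x‖ + 2 * ‖fderiv ℝ φ x‖ := by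
    intro c c' hc hc' hc1
    refine ⟨h _ (hφ.mul ((contDiff_const.add (hc.comp hK)).div_const 2)) (fun x => ?_) ?_,
      fun x => ?_⟩
    · obtain ⟨h1, h2⟩ := hφ01 x
      obtain ⟨h3, h4⟩ := hc1 (K x)
      exact ⟨mul_nonneg h1 (by linarith), mul_le_one₀ h2 (by linarith) (by linarith)⟩
    · rw [← hφW]
      exact Function.support_mul_subset_left _ _
    · have hd : HasFDerivAt (fun x => (1 + c (K x)) / 2) ((c' (K x) / 2) • fderiv ℝ K x) x := by
        have := (((hc' (K x)).const_add 1).div_const 2).comp_hasFDerivAt x (hKd x).hasFDerivAt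
        exact this
      have hd' := ((hφd x).hasFDerivAt.mul hd).fderiv
      have heq : (φ x * c' (K x)) • fderiv ℝ K x =
          (2 : ℝ) • fderiv ℝ (fun x => φ x * ((1 + c (K x)) / 2)) x -
            (1 + c (K x)) • fderiv ℝ φ x := by
        rw [show fderiv ℝ (fun x => φ x * ((1 + c (K x)) / 2)) x = _ from hd', smul_add, smul_smul,
          smul_smul, smul_smul]
        module
      obtain ⟨h3, h4⟩ := hc1 (K x)
      calc φ x * |c' (K x)| * ‖fderiv ℝ K x‖ = ‖(φ x * c' (K x)) • fderiv ℝ K x‖ := by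
            rw [norm_smul, Real.norm_eq_abs, abs_mul, abs_of_nonneg (hφ01 x).1]
        _ ≤ _ := by
            rw [heq]
            refine (norm_sub_le _ _).trans ?_
            rw [norm_smul, norm_smul, Real.norm_of_nonneg zero_le_two,
              Real.norm_of_nonneg (by linarith)]
            gcongr
            linarith
  obtain ⟨hi1, hb1⟩ := hfam Real.contDiff_sin Real.hasDerivAt_sin Real.sin_mem_Icc
  obtain ⟨hi2, hb2⟩ := hfam Real.contDiff_cos Real.hasDerivAt_cos Real.cos_mem_Icc
  have hi0 := h φ hφ hφ01 hφW.subset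
  refine hKint (Integrable.mono' (((hi1.const_mul 2).add (hi2.const_mul 2)).add (hi0.const_mul 4))
    ?_ (Filter.Eventually.of_forall fun x => ?_))
  · exact ((hw.mul hφ.continuous).mul
      (hK.continuous_fderiv two_ne_zero).norm).aestronglyMeasurable
  · have h1 := hb1 x
    have h2 := hb2 x
    rw [abs_neg] at h2
    have hsc : 1 ≤ |Real.cos (K x)| + |Real.sin (K x)| := by
      have := Real.sin_sq_add_cos_sq (K x)
      nlinarith [abs_nonneg (Real.cos (K x)), abs_nonneg (Real.sin (K x)),
        sq_abs (Real.cos (K x)), sq_abs (Real.sin (K x))]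
    have h3 : φ x * ‖fderiv ℝ K x‖ ≤
        φ x * ‖fderiv ℝ K x‖ * (|Real.cos (K x)| + |Real.sin (K x)|) :=
      le_mul_of_one_le_right (mul_nonneg (hφ01 x).1 (norm_nonneg _)) hsc
    rw [Real.norm_of_nonneg
      (mul_nonneg (mul_nonneg (hw0 x).le (hφ01 x).1) (norm_nonneg _)), mul_assoc]
    simp only [Pi.add_apply]
    have h4 : φ x * ‖fderiv ℝ K x‖ ≤ 2 * ‖fderiv ℝ (fun x => φ x * ((1 + Real.sin (K x)) / 2)) x‖ +
        2 * ‖fderiv ℝ (fun x => φ x * ((1 + Real.cos (K x)) / 2)) x‖ + 4 * ‖fderiv ℝ φ x‖ := by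
      linarith
    calc _ ≤ w x * _ := mul_le_mul_of_nonneg_left h4 (hw0 x).le
      _ = _ := by ring

end Oscillation

section Neighborhood

variable {E : Type*} [NormedAddCommGroup E] {R : E → ℝ}

theorem isOpen_setOf_exists_norm_sub_lt (hR : Continuous R) (U : Set E) :
    IsOpen {x | ∃ u ∈ U, ‖x - u‖ < R x / 16} := by
  have : {x | ∃ u ∈ U, ‖x - u‖ < R x / 16} = ⋃ u ∈ U, {x | ‖x - u‖ < R x / 16} := by
    ext x; simp
  rw [this]
  exact isOpen_biUnion fun u _ => isOpen_lt (by fun_prop) (by fun_prop)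

/-- A point which is outside a small neighborhood of `U`, but not too far from `U`, is close to a
ball lying in the small neighborhood of `U` but outside `U`. -/
theorem exists_closedBall_subset_diff [NormedSpace ℝ E] (hR : LipschitzWith 1 R)
    (hpos : ∀ x, 0 < R x) {U : Set E} {x u : E} (hu : u ∈ U) (hxu : ‖x - u‖ < R u / 3)
    (hx : x ∉ {x | ∃ u ∈ U, ‖x - u‖ < R x / 16}) :
    ∃ y, ‖y - x‖ ≤ R x / 2 ∧
      Metric.closedBall y (R x / 128) ⊆ {x | ∃ u ∈ U, ‖x - u‖ < R x / 16} \ U := by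
  have hne : U.Nonempty := ⟨u, hu⟩
  have hx0 := hpos x
  have hu0 := hpos u
  have hxd : R x / 16 ≤ Metric.infDist x U := by
    refine (Metric.le_infDist hne).2 fun {z} hz => ?_
    by_contra! h
    exact hx ⟨z, hz, by rwa [← dist_eq_norm]⟩
  obtain ⟨y, hy, hyd⟩ := (convex_segment (𝕜 := ℝ) u x).isPreconnected.intermediate_value₂
    (left_mem_segment ℝ u x) (right_mem_segment ℝ u x)
    (f := fun z => Metric.infDist z U) (g := fun z => R z / 32)
    (Metric.continuous_infDist_pt U).continuousOn (hR.continuous.div_const 32).continuousOn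
    (by simp only [Metric.infDist_zero_of_mem hu]; positivity) (by linarith)
  have hyx : ‖y - x‖ ≤ ‖x - u‖ := by
    obtain ⟨a, b, ha, hb, hab, rfl⟩ := hy
    have : a • u + b • x - x = a • (u - x) := by
      rw [← eq_sub_iff_add_eq] at hab
      subst hab
      module
    rw [this, norm_smul, Real.norm_of_nonneg ha, norm_sub_rev]
    exact mul_le_of_le_one_left (norm_nonneg _) (by linarith)
  have hyx' := hyx.trans (hR.le_half_of_lt_third hxu).1
  refine ⟨y, hyx', fun z hz => ?_⟩
  rw [mem_closedBall_iff_norm] at hz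
  have h1 := hR.le_add_norm_sub x y
  have h2 := hR.le_add_norm_sub y z
  rw [norm_sub_rev x y] at h1
  rw [norm_sub_rev y z] at h2
  have h3 : Metric.infDist z U ≤ Metric.infDist y U + ‖z - y‖ := by
    rw [← dist_eq_norm]; exact Metric.infDist_le_infDist_add_dist
  have h4 : Metric.infDist y U ≤ Metric.infDist z U + ‖z - y‖ := by
    rw [← dist_eq_norm, dist_comm]; exact Metric.infDist_le_infDist_add_dist
  refine ⟨?_, fun hzU => ?_⟩
  · obtain ⟨v, hv, hzv⟩ := (Metric.infDist_lt_iff hne (x := z) (r := R z / 16)).1 (by linarith)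
    exact ⟨v, hv, by rwa [← dist_eq_norm]⟩
  · rw [Metric.infDist_zero_of_mem hzU] at h4
    linarith

end Neighborhood

section Assembly

set_option maxSynthPendingDepth 3

theorem weighted_fderiv_nonneg {E : Type*} [NormedAddCommGroup E] [NormedSpace ℝ E]
    (f : E → ℝ) (x : E) {r : ℝ} (hr : 0 ≤ r) :
    0 ≤ r * ‖fderiv ℝ f x‖ + r ^ 2 * ‖fderiv ℝ (fderiv ℝ f) x‖ :=
  add_nonneg (mul_nonneg hr (norm_nonneg _)) (mul_nonneg (sq_nonneg _) (norm_nonneg _))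

theorem weighted_fderiv_eq_zero_of_eventuallyEq_const {E : Type*} [NormedAddCommGroup E]
    [NormedSpace ℝ E] {f : E → ℝ} {x : E} {c : ℝ} (h : f =ᶠ[nhds x] fun _ => c) (r : ℝ) :
    r * ‖fderiv ℝ f x‖ + r ^ 2 * ‖fderiv ℝ (fderiv ℝ f) x‖ = 0 := by
  have h1 : fderiv ℝ f =ᶠ[nhds x] fun _ => 0 := by
    filter_upwards [h.fderiv (𝕜 := ℝ)] with y hy
    rw [hy, fderiv_fun_const, Pi.zero_apply]
  rw [h1.self_of_nhds, h1.fderiv_eq, fderiv_fun_const, Pi.zero_apply, norm_zero, norm_zero,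
    mul_zero, mul_zero, add_zero]

theorem integrable_mul_norm_fderiv_of_integrable {E : Type*} [NormedAddCommGroup E]
    [NormedSpace ℝ E] [MeasurableSpace E] [OpensMeasurableSpace E] [SecondCountableTopology E]
    {μ : Measure E} {R f : E → ℝ} (hR : Continuous R) (hpos : ∀ x, 0 < R x) (hf : ContDiff ℝ 2 f)
    (h : Integrable (fun x => R x * ‖fderiv ℝ f x‖ + R x ^ 2 * ‖fderiv ℝ (fderiv ℝ f) x‖) μ) :
    Integrable (fun x => R x * ‖fderiv ℝ f x‖) μ := by
  refine h.mono' (hR.mul (hf.continuous_fderiv two_ne_zero).norm).aestronglyMeasurable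
    (Filter.Eventually.of_forall fun x => ?_)
  rw [Real.norm_of_nonneg (mul_nonneg (hpos x).le (norm_nonneg _))]
  exact le_add_of_nonneg_right (mul_nonneg (sq_nonneg _) (norm_nonneg _))

end Assembly

/-- Theorem 2.1: for every closed `U ⊂ ℝ^d` there is a C² function
`f : ℝ^d → [0,1]`, equal to `1` on `U` and `0` outside `U_{+4}`, with
`∫ (R |∇f| + R² |∇²f|) dm ≤ C ∫_{U_{+4} \ U} f dm`, `C` depending only on `d`. -/
theorem stmt_6 (d : ℕ) :
    ∃ C : ℝ, 0 < C ∧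
    ∀ R : EuclideanSpace ℝ (Fin d) → ℝ, LipschitzWith 1 R → (∀ x, 0 < R x) →
    ∀ U : Set (EuclideanSpace ℝ (Fin d)), IsClosed U →
      ∃ f : EuclideanSpace ℝ (Fin d) → ℝ,
        ContDiff ℝ 2 f ∧
        (∀ x, f x ∈ Set.Icc (0:ℝ) 1) ∧
        (∀ x ∈ U, f x = 1) ∧
        (∀ x ∉ nbhd R U 4, f x = 0) ∧
        ∫ x, (R x * ‖fderiv ℝ f x‖ + R x ^ 2 * ‖fderiv ℝ (fderiv ℝ f) x‖) ≤
          C * ∫ x in nbhd R U 4 \ U, f x := by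
  obtain ⟨K, hK, hcut⟩ := exists_cutoff (EuclideanSpace ℝ (Fin d))
  refine ⟨K * 672 ^ Module.finrank ℝ (EuclideanSpace ℝ (Fin d)), by positivity,
    fun R hR hpos U hU => ?_⟩
  obtain ⟨f, hf, hf01, hf1, hfsupp, hfK⟩ := hcut R hR hpos U
  set T : Set (EuclideanSpace ℝ (Fin d)) := {x | ∃ u ∈ U, ‖x - u‖ < R x / 16}
  have hTo : IsOpen T := isOpen_setOf_exists_norm_sub_lt hR.continuous U
  have hTf : ∀ x ∈ T, f x = 1 := fun x ⟨u, hu, hxu⟩ => hf1 x u hu hxu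
  have hUT : U ⊆ T := fun u hu => ⟨u, hu, by simpa using hpos u⟩
  have hWo : IsOpen (T \ U) := hTo.sdiff hU
  have hf0 : ∀ x ∉ nbhd R U 4, f x = 0 := by
    intro x hx
    by_contra h
    obtain ⟨u, hu, hxu⟩ := hfsupp x (subset_tsupport f h)
    exact hx ⟨u, hu, (specialDist_le hR hpos (by linarith [hpos u])).trans (by norm_num)⟩
  have hTN : T ⊆ nbhd R U 4 := fun x hx => by
    by_contra h
    exact one_ne_zero ((hTf x hx).symm.trans (hf0 x h))
  by_cases hμ : volume (T \ U) = ⊤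
  · by_cases hint : Integrable fun x =>
        R x * ‖fderiv ℝ f x‖ + R x ^ 2 * ‖fderiv ℝ (fderiv ℝ f) x‖
    · obtain ⟨g, hg, hg01, hgW, hgint⟩ :=
        exists_gradient_not_integrable hR.continuous hpos hWo hμ
      have hgz : ∀ x ∉ T \ U, g x = 0 := fun x hx => by
        by_contra h
        exact hx (hgW h)
      have hfg : ∀ x, f x - g x ∈ Set.Icc (0 : ℝ) 1 := by
        intro x
        by_cases hx : x ∈ T \ U
        · rw [hTf x hx.1]
          exact ⟨by linarith [(hg01 x).2], by linarith [(hg01 x).1]⟩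
        · rw [hgz x hx, sub_zero]
          exact hf01 x
      refine ⟨fun x => f x - g x, hf.sub hg, hfg, fun x hx => ?_, fun x hx => ?_, ?_⟩
      · change f x - g x = 1
        rw [hgz x fun h => h.2 hx, hTf x (hUT hx), sub_zero]
      · change f x - g x = 0
        rw [hgz x fun h => hx (hTN h.1), hf0 x hx, sub_zero]
      · rw [integral_undef]
        · exact mul_nonneg (by positivity) (integral_nonneg fun x => (hfg x).1)
        · intro hint'
          refine hgint (((integrable_mul_norm_fderiv_of_integrable hR.continuous hpos hf hint).add
            (integrable_mul_norm_fderiv_of_integrable hR.continuous hpos (hf.sub hg) hint')).mono'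
            (hR.continuous.mul (hg.continuous_fderiv two_ne_zero).norm).aestronglyMeasurable
            (Filter.Eventually.of_forall fun x => ?_))
          have hd : fderiv ℝ (fun x => f x - g x) x = fderiv ℝ f x - fderiv ℝ g x :=
            fderiv_fun_sub (hf.differentiable two_ne_zero x) (hg.differentiable two_ne_zero x)
          have hle : ‖fderiv ℝ g x‖ ≤ ‖fderiv ℝ f x‖ + ‖fderiv ℝ (fun x => f x - g x) x‖ := by
            rw [hd]
            calc ‖fderiv ℝ g x‖ = ‖fderiv ℝ f x - (fderiv ℝ f x - fderiv ℝ g x)‖ := by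
                  rw [sub_sub_cancel]
              _ ≤ _ := norm_sub_le _ _
          rw [Real.norm_of_nonneg (mul_nonneg (hpos x).le (norm_nonneg _)), Pi.add_apply, ← mul_add]
          exact mul_le_mul_of_nonneg_left hle (hpos x).le
    · refine ⟨f, hf, hf01, fun x hx => hTf x (hUT hx), hf0, ?_⟩
      rw [integral_undef hint]
      exact mul_nonneg (by positivity) (integral_nonneg fun x => (hf01 x).1)
  · refine ⟨f, hf, hf01, fun x hx => hTf x (hUT hx), hf0, ?_⟩
    set A := tsupport f \ T
    have hA : MeasurableSet A := (isClosed_tsupport f).measurableSet.diff hTo.measurableSet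
    have hAW := measure_le_of_forall_exists_closedBall_subset (μ := volume) hR hpos hA
      (W := T \ U) fun x hx => by
        obtain ⟨u, hu, hxu⟩ := hfsupp x hx.1
        exact exists_closedBall_subset_diff hR hpos hu hxu hx.2
    have hAfin : volume A ≠ ⊤ :=
      (hAW.trans_lt (ENNReal.mul_lt_top ENNReal.ofReal_lt_top (lt_top_iff_ne_top.2 hμ))).ne
    have hAW' : volume.real A ≤
        672 ^ Module.finrank ℝ (EuclideanSpace ℝ (Fin d)) * volume.real (T \ U) := by
      have := ENNReal.toReal_mono (ENNReal.mul_ne_top ENNReal.ofReal_ne_top hμ) hAW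
      rwa [ENNReal.toReal_mul, ENNReal.toReal_ofReal (by positivity)] at this
    have hfint : IntegrableOn f (nbhd R U 4 \ U) := by
      refine IntegrableOn.mono_set (t := Uᶜ) ?_ fun x hx => hx.2
      have hM : MeasurableSet (A ∪ T \ U) := hA.union hWo.measurableSet
      refine Integrable.mono' (g := (A ∪ T \ U).indicator fun _ => (1 : ℝ))
        (((integrable_indicator_iff hM).2 (integrableOn_const
          (measure_union_lt_top (lt_top_iff_ne_top.2 hAfin) (lt_top_iff_ne_top.2 hμ)).ne)).restrict)
        hf.continuous.aestronglyMeasurable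
        (ae_restrict_of_forall_mem hU.measurableSet.compl fun x hx => ?_)
      rw [Real.norm_of_nonneg (hf01 x).1]
      by_cases hxM : x ∈ A ∪ T \ U
      · rw [Set.indicator_of_mem hxM]; exact (hf01 x).2
      · rw [Set.indicator_of_notMem hxM]
        refine le_of_eq (image_eq_zero_of_notMem_tsupport fun hxs => hxM ?_)
        by_cases hxT : x ∈ T
        exacts [Or.inr ⟨hxT, hx⟩, Or.inl ⟨hxs, hxT⟩]
    have hlower : volume.real (T \ U) ≤ ∫ x in nbhd R U 4 \ U, f x := by
      calc volume.real (T \ U) = ∫ _ in T \ U, (1 : ℝ) := by simp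
        _ = ∫ x in T \ U, f x :=
            setIntegral_congr_fun hWo.measurableSet fun x hx => (hTf x hx.1).symm
        _ ≤ _ := setIntegral_mono_set hfint (Filter.Eventually.of_forall fun x => (hf01 x).1)
            (Set.sdiff_subset_sdiff_left hTN).eventuallyLE
    have hupper : ∫ x, (R x * ‖fderiv ℝ f x‖ + R x ^ 2 * ‖fderiv ℝ (fderiv ℝ f) x‖) ≤
        K * volume.real A := by
      calc _ ≤ ∫ x, A.indicator (fun _ => K) x := by
            refine integral_mono_of_nonneg (Filter.Eventually.of_forall fun x => ?_)
              ((integrable_indicator_iff hA).2 (integrableOn_const hAfin))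
              (Filter.Eventually.of_forall fun x => ?_)
            · exact weighted_fderiv_nonneg f x (hpos x).le
            · by_cases hxA : x ∈ A
              · rw [Set.indicator_of_mem hxA]; exact hfK x
              · have hc : ∃ c : ℝ, f =ᶠ[nhds x] fun _ => c := by
                  by_cases hxT : x ∈ T
                  · exact ⟨1, Filter.eventually_of_mem (hTo.mem_nhds hxT) hTf⟩
                  · exact ⟨0, notMem_tsupport_iff_eventuallyEq.1 fun h => hxA ⟨h, hxT⟩⟩
                obtain ⟨c, hc⟩ := hc
                rw [Set.indicator_of_notMem hxA]
                exact (weighted_fderiv_eq_zero_of_eventuallyEq_const hc (R x)).le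
        _ = K * volume.real A := by
            rw [integral_indicator hA, setIntegral_const, smul_eq_mul, mul_comm]
    calc _ ≤ K * volume.real A := hupper
      _ ≤ K * (672 ^ Module.finrank ℝ (EuclideanSpace ℝ (Fin d)) * volume.real (T \ U)) := by
          gcongr
      _ = K * 672 ^ Module.finrank ℝ (EuclideanSpace ℝ (Fin d)) * volume.real (T \ U) := by ring
      _ ≤ _ := by gcongr
end

section
/- There exists a constant c > 0 depending only on d with the following property. Let u : ℝ^d → ℝ be a C² function and let ρ be the special metric corresponding to a 1-Lipschitz function R : ℝ^d → (0,∞). If |u(x)| ≤ c·R(x)² and Δu(x) ≥ −1 for all x ∈ ℝ^d, then for every compact set U ⊂ ℝ^d: ∫_U Δu dm ≤ m(U_{+4} \ U) and −∫_{U_{+4}} Δu dm ≤ m(U_{+4} \ U). -/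
open MeasureTheory

/-- The Laplacian `Δu(x) = ∑ᵢ ∂²u/∂xᵢ²`. -/
noncomputable def lap {d : ℕ} (u : EuclideanSpace ℝ (Fin d) → ℝ)
    (x : EuclideanSpace ℝ (Fin d)) : ℝ :=
  ∑ i : Fin d, fderiv ℝ (fderiv ℝ u) x (EuclideanSpace.single i 1) (EuclideanSpace.single i 1)

section SpecialDist

variable {d : ℕ} {R : EuclideanSpace ℝ (Fin d) → ℝ}

theorem specialDist_le_of_dist_le (hR : LipschitzWith 1 R) (hpos : ∀ x, 0 < R x)
    {x y : EuclideanSpace ℝ (Fin d)} (h : dist y x ≤ 4 / 5 * R x) :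
    specialDist R x y ≤ 4 := by
  have hbdd : BddBelow { L | ∃ γ γ' : ℝ → EuclideanSpace ℝ (Fin d),
      (∀ t ∈ Set.Icc (0:ℝ) 1, HasDerivAt γ (γ' t) t) ∧
      ContinuousOn γ' (Set.Icc 0 1) ∧ γ 0 = x ∧ γ 1 = y ∧
      L = ∫ t in (0:ℝ)..1, ‖γ' t‖ / R (γ t) } := by
    refine ⟨0, ?_⟩
    rintro L ⟨γ, γ', -, -, -, -, rfl⟩
    exact intervalIntegral.integral_nonneg zero_le_one
      fun t _ => div_nonneg (norm_nonneg _) (hpos _).le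
  refine (csInf_le hbdd ⟨fun t => x + t • (y - x), fun _ => y - x, ?_,
    continuousOn_const, by simp, by simp, rfl⟩).trans ?_
  · intro t _
    simpa using ((hasDerivAt_id t).smul_const (y - x)).const_add x
  · have hx := hpos x
    have key : ∀ t ∈ Set.uIoc (0:ℝ) 1, ‖‖y - x‖ / R (x + t • (y - x))‖ ≤ 4 := by
      intro t ht
      rw [Set.uIoc_of_le zero_le_one] at ht
      have h1 := hR.dist_le_mul x (x + t • (y - x))
      rw [dist_eq_norm y x] at h
      have h2 : dist x (x + t • (y - x)) ≤ ‖y - x‖ := by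
        rw [dist_self_add_right, norm_smul, Real.norm_of_nonneg ht.1.le]
        exact mul_le_of_le_one_left (norm_nonneg _) ht.2
      rw [Real.dist_eq] at h1
      have h3 := (abs_le.mp h1).2
      simp only [NNReal.coe_one, one_mul] at h3
      rw [Real.norm_of_nonneg (div_nonneg (norm_nonneg _) (hpos _).le), div_le_iff₀ (hpos _)]
      linarith
    simpa using (Real.le_norm_self _).trans
      (intervalIntegral.norm_integral_le_of_norm_le_const key)

theorem dist_le_of_integral_le (hR : LipschitzWith 1 R) (hpos : ∀ x, 0 < R x)
    {γ γ' : ℝ → EuclideanSpace ℝ (Fin d)} {L : ℝ}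
    (hγ : ∀ t ∈ Set.Icc (0:ℝ) 1, HasDerivAt γ (γ' t) t) (hγ' : ContinuousOn γ' (Set.Icc 0 1))
    (hL : ∫ t in (0:ℝ)..1, ‖γ' t‖ / R (γ t) ≤ L) :
    dist (γ 1) (γ 0) ≤ R (γ 0) * Real.exp L := by
  set g : ℝ → ℝ := Set.IccExtend zero_le_one
    ((Set.Icc (0:ℝ) 1).domRestrict fun t => ‖γ' t‖) with hg
  have gcont : Continuous g := (continuousOn_iff_continuous_domRestrict.mp hγ'.norm).Icc_extend'
  have geq : ∀ t ∈ Set.Icc (0:ℝ) 1, g t = ‖γ' t‖ := fun t ht => by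
    rw [hg, Set.IccExtend_of_mem _ _ ht]; rfl
  set f : ℝ → ℝ := fun t => R (γ 0) + ∫ s in (0:ℝ)..t, g s with hf
  have fder : ∀ t, HasDerivAt f (g t) t := fun t =>
    (intervalIntegral.integral_hasDerivAt_right (gcont.intervalIntegrable _ _)
      (gcont.stronglyMeasurableAtFilter _ _) gcont.continuousAt).const_add _
  have fcont : Continuous f := continuous_iff_continuousAt.mpr fun t => (fder t).continuousAt
  have gnonneg : ∀ t, 0 ≤ g t := fun t => norm_nonneg _
  have dist_le : ∀ t ∈ Set.Icc (0:ℝ) 1, dist (γ t) (γ 0) ≤ ∫ s in (0:ℝ)..t, g s := by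
    intro t ht
    have hsub : Set.uIcc 0 t ⊆ Set.Icc (0:ℝ) 1 := by
      rw [Set.uIcc_of_le ht.1]; exact Set.Icc_subset_Icc_right ht.2
    rw [dist_eq_norm, ← intervalIntegral.integral_eq_sub_of_hasDerivAt
      (fun s hs => hγ s (hsub hs)) ((hγ'.mono hsub).intervalIntegrable)]
    refine (intervalIntegral.norm_integral_le_integral_norm ht.1).trans_eq ?_
    exact intervalIntegral.integral_congr fun s hs => (geq s (hsub hs)).symm
  have fpos : ∀ t ∈ Set.Icc (0:ℝ) 1, 0 < f t := fun t ht =>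
    add_pos_of_pos_of_nonneg (hpos _) (dist_nonneg.trans (dist_le t ht))
  have Rle : ∀ t ∈ Set.Icc (0:ℝ) 1, R (γ t) ≤ f t := by
    intro t ht
    have h1 := hR.dist_le_mul (γ t) (γ 0)
    rw [Real.dist_eq] at h1
    have h3 := (abs_le.mp h1).2
    simp only [NNReal.coe_one, one_mul] at h3
    have := dist_le t ht
    simp only [hf]; linarith
  have γcont : ContinuousOn γ (Set.Icc 0 1) := fun t ht => (hγ t ht).continuousAt.continuousWithinAt
  have u01 : Set.uIcc (0:ℝ) 1 = Set.Icc 0 1 := Set.uIcc_of_le zero_le_one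
  have hint : IntervalIntegrable (fun t => g t / f t) volume 0 1 := by
    apply ContinuousOn.intervalIntegrable
    rw [u01]
    exact gcont.continuousOn.div fcont.continuousOn fun t ht => (fpos t ht).ne'
  have hlog : ∫ t in (0:ℝ)..1, g t / f t = Real.log (f 1) - Real.log (f 0) :=
    intervalIntegral.integral_eq_sub_of_hasDerivAt (f := fun t => Real.log (f t))
      (fun t ht => (fder t).log (fpos t (u01 ▸ ht)).ne') hint
  have hle : ∫ t in (0:ℝ)..1, g t / f t ≤ ∫ t in (0:ℝ)..1, ‖γ' t‖ / R (γ t) := by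
    refine intervalIntegral.integral_mono_on zero_le_one hint ?_ ?_
    · apply ContinuousOn.intervalIntegrable
      rw [u01]
      exact hγ'.norm.div (hR.continuous.comp_continuousOn γcont) fun t _ => (hpos _).ne'
    · intro t ht
      rw [geq t ht]
      exact div_le_div_of_nonneg_left (norm_nonneg _) (hpos _) (Rle t ht)
  have f0 : f 0 = R (γ 0) := by simp [hf]
  have one_mem : (1:ℝ) ∈ Set.Icc (0:ℝ) 1 := ⟨zero_le_one, le_rfl⟩
  have h1 : Real.log (f 1) ≤ Real.log (R (γ 0)) + L := by rw [← f0]; linarith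
  have h2 : f 1 ≤ R (γ 0) * Real.exp L := by
    rw [← Real.exp_log (fpos 1 one_mem)]
    refine (Real.exp_le_exp.mpr h1).trans_eq ?_
    rw [Real.exp_add, Real.exp_log (hpos _)]
  have h3 := dist_le 1 one_mem
  have h4 := hpos (γ 0)
  simp only [hf] at h2
  linarith

theorem dist_le_of_specialDist_lt (hR : LipschitzWith 1 R) (hpos : ∀ x, 0 < R x)
    {x y : EuclideanSpace ℝ (Fin d)} {L : ℝ} (h : specialDist R x y < L) :
    dist y x ≤ R x * Real.exp L := by
  obtain ⟨_, ⟨γ, γ', hγ, hγ', rfl, rfl, rfl⟩, hL⟩ := exists_lt_of_csInf_lt (by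
    refine ⟨_, fun t => x + t • (y - x), fun _ => y - x, fun t _ => ?_,
      continuousOn_const, by simp, by simp, rfl⟩
    simpa using ((hasDerivAt_id t).smul_const (y - x)).const_add x) h
  exact dist_le_of_integral_le hR hpos hγ hγ' hL.le

theorem isBounded_nbhd (hR : LipschitzWith 1 R) (hpos : ∀ x, 0 < R x)
    {U : Set (EuclideanSpace ℝ (Fin d))} (hU : IsCompact U) (r : ℝ) :
    Bornology.IsBounded (nbhd R U r) := by
  obtain ⟨M, hM⟩ := hU.bddAbove_image hR.continuous.continuousOn
  obtain ⟨B, hB⟩ := hU.isBounded.subset_closedBall 0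
  refine Metric.isBounded_closedBall.subset
    (t := Metric.closedBall 0 (M * Real.exp (r + 1) + B)) ?_
  rintro y ⟨x, hx, hxy⟩
  have h1 := dist_le_of_specialDist_lt hR hpos (hxy.trans_lt (lt_add_one r))
  have h2 : R x * Real.exp (r + 1) ≤ M * Real.exp (r + 1) :=
    mul_le_mul_of_nonneg_right (hM ⟨x, hx, rfl⟩) (Real.exp_pos _).le
  have h3 : dist x 0 ≤ B := hB hx
  have h4 := dist_triangle y x 0
  rw [Metric.mem_closedBall]
  linarith

end SpecialDist

section Laplacian

variable {d : ℕ} {f g : EuclideanSpace ℝ (Fin d) → ℝ}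

theorem ContDiff.continuous_lap (hf : ContDiff ℝ 2 f) : Continuous (lap f) := by
  have h1 : ContDiff ℝ 1 (fderiv ℝ f) := hf.fderiv_right (by norm_num)
  have h2 : Continuous (fderiv ℝ (fderiv ℝ f)) := h1.continuous_fderiv (by norm_num)
  unfold lap
  fun_prop

theorem lap_congr {x : EuclideanSpace ℝ (Fin d)} (h : f =ᶠ[nhds x] g) : lap f x = lap g x := by
  simp only [lap, h.fderiv.fderiv_eq]

theorem lap_const (c : ℝ) (x : EuclideanSpace ℝ (Fin d)) : lap (fun _ => c) x = 0 := by
  simp [lap]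

theorem lap_const_sub (c : ℝ) (x : EuclideanSpace ℝ (Fin d)) :
    lap (fun y => c - f y) x = -lap f x := by
  have h : fderiv ℝ (fun y => c - f y) = fun y => -fderiv ℝ f y := by
    funext y; exact fderiv_const_sub c
  simp [lap, h, fderiv_fun_neg]

theorem abs_lap_le (x : EuclideanSpace ℝ (Fin d)) :
    |lap f x| ≤ d * ‖iteratedFDeriv ℝ 2 f x‖ := by
  have h : ∀ i ∈ (Finset.univ : Finset (Fin d)),
      |fderiv ℝ (fderiv ℝ f) x (EuclideanSpace.single i 1) (EuclideanSpace.single i 1)| ≤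
        ‖iteratedFDeriv ℝ 2 f x‖ := by
    intro i _
    have := (iteratedFDeriv ℝ 2 f x).le_opNorm
      (fun _ => (EuclideanSpace.single i 1 : EuclideanSpace ℝ (Fin d)))
    simpa [iteratedFDeriv_two_apply] using this
  refine (Finset.abs_sum_le_sum_abs _ _).trans ((Finset.sum_le_sum h).trans_eq ?_)
  simp

theorem fderiv_fderiv_apply (hf : ContDiff ℝ 2 f) (x v w : EuclideanSpace ℝ (Fin d)) :
    fderiv ℝ (fun y => fderiv ℝ f y w) x v = fderiv ℝ (fderiv ℝ f) x v w := by
  have h1 : ContDiff ℝ 1 (fderiv ℝ f) := hf.fderiv_right (by norm_num)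
  rw [fderiv_clm_apply (h1.differentiable (by norm_num) x) (by fun_prop)]
  simp

/-- Green's identity for a compactly supported function. -/
theorem integral_mul_lap (hf : ContDiff ℝ 2 f) (hg : ContDiff ℝ 2 g) (hc : HasCompactSupport f) :
    ∫ x, f x * lap g x = ∫ x, lap f x * g x := by
  have hf1 : ContDiff ℝ 1 (fderiv ℝ f) := hf.fderiv_right (by norm_num)
  have hg1 : ContDiff ℝ 1 (fderiv ℝ g) := hg.fderiv_right (by norm_num)
  have hf2 : Continuous (fderiv ℝ (fderiv ℝ f)) := hf1.continuous_fderiv (by norm_num)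
  have hg2 : Continuous (fderiv ℝ (fderiv ℝ g)) := hg1.continuous_fderiv (by norm_num)
  have hfc := hf.continuous
  have hgc := hg.continuous
  have hf1c := hf1.continuous
  have hg1c := hg1.continuous
  have hc1 : HasCompactSupport (fderiv ℝ f) := hc.fderiv ℝ
  have hc2 : HasCompactSupport (fderiv ℝ (fderiv ℝ f)) := hc1.fderiv ℝ
  have app {F : Type} [NormedAddCommGroup F] [NormedSpace ℝ F]
      {φ : EuclideanSpace ℝ (Fin d) → EuclideanSpace ℝ (Fin d) →L[ℝ] F}
      (h : HasCompactSupport φ) (v : EuclideanSpace ℝ (Fin d)) :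
      HasCompactSupport fun x => φ x v :=
    h.comp_left (g := fun L : EuclideanSpace ℝ (Fin d) →L[ℝ] F => L v) (by simp)
  have i1 : ∀ v w, Integrable fun x => f x * fderiv ℝ (fderiv ℝ g) x v w := fun v w =>
    Continuous.integrable_of_hasCompactSupport (by fun_prop) hc.mul_right
  have i2 : ∀ v w, Integrable fun x => fderiv ℝ (fderiv ℝ f) x v w * g x := fun v w =>
    Continuous.integrable_of_hasCompactSupport (by fun_prop) (app (app hc2 v) w).mul_right
  have i3 : ∀ v w, Integrable fun x => fderiv ℝ f x v * fderiv ℝ g x w := fun v w =>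
    Continuous.integrable_of_hasCompactSupport (by fun_prop) (app hc1 v).mul_right
  have i4 : ∀ v, Integrable fun x => f x * fderiv ℝ g x v := fun v =>
    Continuous.integrable_of_hasCompactSupport (by fun_prop) hc.mul_right
  have i5 : ∀ v, Integrable fun x => fderiv ℝ f x v * g x := fun v =>
    Continuous.integrable_of_hasCompactSupport (by fun_prop) (app hc1 v).mul_right
  have key : ∀ v, ∫ x, f x * fderiv ℝ (fderiv ℝ g) x v v
      = ∫ x, fderiv ℝ (fderiv ℝ f) x v v * g x := by
    intro v
    have e1 := integral_mul_fderiv_eq_neg_fderiv_mul_of_integrable (μ := volume) (v := v)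
      (f := f) (g := fun x => fderiv ℝ g x v) (i3 v v)
      (by simpa only [fderiv_fderiv_apply hg] using i1 v v) (i4 v)
      (fun x _ => hf.differentiable (by norm_num) x)
      (fun x _ => (hg1.differentiable (by norm_num) x).clm_apply (by fun_prop))
    have e2 := integral_mul_fderiv_eq_neg_fderiv_mul_of_integrable (μ := volume) (v := v)
      (f := fun x => fderiv ℝ f x v) (g := g)
      (by simpa only [fderiv_fderiv_apply hf] using i2 v v) (i3 v v) (i5 v)
      (fun x _ => (hf1.differentiable (by norm_num) x).clm_apply (by fun_prop))
      (fun x _ => hg.differentiable (by norm_num) x)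
    simp only [fderiv_fderiv_apply hg] at e1
    simp only [fderiv_fderiv_apply hf] at e2
    rw [e1, e2, neg_neg]
  simp only [lap, Finset.mul_sum, Finset.sum_mul]
  rw [integral_finsetSum _ fun i _ => i1 _ _, integral_finsetSum _ fun i _ => i2 _ _]
  exact Finset.sum_congr rfl fun i _ => key _

end Laplacian

section Cutoff

theorem exists_uniform_bound {α : Type*} {s : Set α} {a : ℕ → α → ℝ}
    (h : ∀ i, ∃ M, ∀ x ∈ s, a i x ≤ M) (n : ℕ) :
    ∃ M, 1 ≤ M ∧ ∀ i ≤ n, ∀ x ∈ s, a i x ≤ M := by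
  choose M hM using h
  refine ⟨1 + ∑ i ∈ Finset.range (n + 1), |M i|,
    le_add_of_nonneg_right (Finset.sum_nonneg fun _ _ => abs_nonneg _), fun i hi x hx => ?_⟩
  have h1 := Finset.single_le_sum (f := fun i => |M i|) (fun j _ => abs_nonneg (M j))
    (Finset.mem_range.mpr (Nat.lt_succ_of_le hi))
  linarith [hM i x hx, le_abs_self (M i)]

variable {d : ℕ}

theorem card_le_of_pairwiseDisjoint_closedBall {J : Finset (EuclideanSpace ℝ (Fin d))}
    {x : EuclideanSpace ℝ (Fin d)} {s A : ℝ} (hs : 0 < s) (hA : 0 ≤ A)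
    (hdisj : (J : Set (EuclideanSpace ℝ (Fin d))).PairwiseDisjoint
      fun y => Metric.closedBall y s)
    (hJ : ∀ y ∈ J, Metric.closedBall y s ⊆ Metric.closedBall x (A * s)) :
    (J.card : ℝ) ≤ A ^ d := by
  have hb : ∀ (y : EuclideanSpace ℝ (Fin d)) (r : ℝ), 0 ≤ r →
      volume.real (Metric.closedBall y r)
        = r ^ d * volume.real (Metric.ball (0 : EuclideanSpace ℝ (Fin d)) 1) := fun y r hr => by
    simpa using Measure.addHaar_real_closedBall volume y hr
  have hv : 0 < volume.real (Metric.ball (0 : EuclideanSpace ℝ (Fin d)) 1) :=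
    ENNReal.toReal_pos (Metric.measure_ball_pos _ _ one_pos).ne' measure_ball_lt_top.ne
  have h1 : volume.real (⋃ y ∈ J, Metric.closedBall y s)
      = ∑ y ∈ J, volume.real (Metric.closedBall y s) :=
    measureReal_biUnion_finset hdisj (fun _ _ => measurableSet_closedBall)
      fun _ _ => measure_closedBall_lt_top.ne
  have h2 : volume.real (⋃ y ∈ J, Metric.closedBall y s)
      ≤ volume.real (Metric.closedBall x (A * s)) :=
    measureReal_mono (Set.iUnion₂_subset hJ) measure_closedBall_lt_top.ne
  rw [h1, hb _ _ (by positivity), Finset.sum_congr rfl fun y _ => hb y s hs.le,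
    Finset.sum_const, nsmul_eq_mul, mul_pow, mul_assoc] at h2
  exact le_of_mul_le_mul_right h2 (by positivity)

variable {R : EuclideanSpace ℝ (Fin d) → ℝ}

theorem LipschitzWith.le_add_dist (hR : LipschitzWith 1 R) (x y : EuclideanSpace ℝ (Fin d)) :
    R x ≤ R y + dist x y := by
  have h := (abs_le.mp ((Real.dist_eq _ _).symm.trans_le (hR.dist_le_mul x y))).2
  simp only [NNReal.coe_one, one_mul] at h
  linarith

theorem card_filter_dist_le (hR : LipschitzWith 1 R) (hpos : ∀ x, 0 < R x)
    {J : Finset (EuclideanSpace ℝ (Fin d))}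
    (hdisj : (J : Set (EuclideanSpace ℝ (Fin d))).PairwiseDisjoint
      fun y => Metric.closedBall y (R y / 100))
    (x : EuclideanSpace ℝ (Fin d)) [DecidablePred fun y => dist x y ≤ R y / 10] :
    ((J.filter fun y => dist x y ≤ R y / 10).card : ℝ) ≤ 110 ^ d := by
  have hx := hpos x
  refine card_le_of_pairwiseDisjoint_closedBall (x := x) (s := R x / 110) (by positivity)
    (by norm_num) ?_ ?_
  · refine (hdisj.subset (Finset.coe_subset.mpr (Finset.filter_subset _ _))).mono_on ?_
    intro y hy
    have hy' : dist x y ≤ R y / 10 := (Finset.mem_filter.mp hy).2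
    have := hR.le_add_dist x y
    exact Metric.closedBall_subset_closedBall (by linarith)
  · intro y hy
    have hy' : dist x y ≤ R y / 10 := (Finset.mem_filter.mp hy).2
    have := hR.le_add_dist y x
    refine Metric.closedBall_subset_closedBall' ?_
    rw [dist_comm] at this ⊢
    linarith

theorem norm_iteratedFDeriv_comp_inv_smul_sub {b : EuclideanSpace ℝ (Fin d) → ℝ} {i : ℕ}
    (hb : ContDiff ℝ i b) {B r : ℝ} (hr : 0 < r) (hB : ∀ x, ‖iteratedFDeriv ℝ i b x‖ ≤ B)
    (x y : EuclideanSpace ℝ (Fin d)) :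
    ‖iteratedFDeriv ℝ i (fun z => b (r⁻¹ • (z - y))) x‖ ≤ r⁻¹ ^ i * B := by
  rw [iteratedFDeriv_comp_sub i y (f := fun z => b (r⁻¹ • z)), iteratedFDeriv_comp_const_smul _ hb,
    norm_smul, norm_pow, Real.norm_of_nonneg (by positivity)]
  gcongr
  exact hB _

theorem exists_disjoint_cover (hpos : ∀ x, 0 < R x) (hR : Continuous R)
    {K : Set (EuclideanSpace ℝ (Fin d))} (hK : IsCompact K) :
    ∃ J : Finset (EuclideanSpace ℝ (Fin d)), ↑J ⊆ K ∧
      (J : Set (EuclideanSpace ℝ (Fin d))).PairwiseDisjoint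
        (fun y => Metric.closedBall y (R y / 100)) ∧
      ∀ x ∈ K, ∃ y ∈ J, Metric.closedBall y (R y / 20) ∈ nhds x := by
  obtain ⟨t, htK, ht⟩ := hK.elim_nhds_subcover (fun y => Metric.ball y (R y / 100))
    fun y _ => Metric.ball_mem_nhds y (by have := hpos y; positivity)
  obtain ⟨M, hM⟩ := hK.bddAbove_image hR.continuousOn
  obtain ⟨u, hut, hdisj, hu⟩ := Vitali.exists_disjoint_subfamily_covering_enlargement_closedBall
    (t : Set (EuclideanSpace ℝ (Fin d))) id (fun y => R y / 100) (M / 100)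
    (fun y hy => by have := hM ⟨y, htK y hy, rfl⟩; linarith) 5 (by norm_num)
  have hfin : u.Finite := t.finite_toSet.subset hut
  refine ⟨hfin.toFinset, fun y hy => htK y (hut (by simpa using hy)), by simpa using hdisj, ?_⟩
  intro x hx
  obtain ⟨a, ha, hxa⟩ := Set.mem_iUnion₂.mp (ht hx)
  obtain ⟨y, hy, hay⟩ := hu a ha
  refine ⟨y, by simpa using hy, Filter.mem_of_superset (Metric.isOpen_ball.mem_nhds hxa) ?_⟩
  refine Metric.ball_subset_closedBall.trans (hay.trans (Metric.closedBall_subset_closedBall ?_))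
  linarith

/-- A compact set can be cut out at the scale `R`: the cutoff equals one near the set and on
disjoint balls of size comparable to `R`, and vanishes off the enlargements of these balls. -/
theorem exists_cutoff_s7 (d : ℕ) :
    ∃ C : ℝ, 0 < C ∧ ∀ R : EuclideanSpace ℝ (Fin d) → ℝ, LipschitzWith 1 R → (∀ x, 0 < R x) →
      ∀ K : Set (EuclideanSpace ℝ (Fin d)), IsCompact K →
      ∃ (J : Finset (EuclideanSpace ℝ (Fin d))) (χ : EuclideanSpace ℝ (Fin d) → ℝ),
        ↑J ⊆ K ∧
        (J : Set (EuclideanSpace ℝ (Fin d))).PairwiseDisjoint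
          (fun y => Metric.closedBall y (R y / 100)) ∧
        ContDiff ℝ 2 χ ∧ (∀ x, 0 ≤ χ x) ∧ (∀ x, χ x ≤ 1) ∧
        (∀ x ∈ K, χ =ᶠ[nhds x] fun _ => 1) ∧
        (∀ y ∈ J, ∀ x ∈ Metric.closedBall y (R y / 100), χ x = 1) ∧
        (∀ x, χ x ≠ 0 → ∃ y ∈ J, dist x y ≤ R y / 10) ∧
        ∀ x, |lap χ x| * R x ^ 2 ≤ C := by
  classical
  let b : ContDiffBump (0 : EuclideanSpace ℝ (Fin d)) := ⟨5, 10, by norm_num, by norm_num⟩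
  have bsmooth : ∀ i : ℕ, ContDiff ℝ i b := fun i => b.contDiff
  obtain ⟨B, hB1, hB⟩ := exists_uniform_bound (s := Set.univ)
    (a := fun i x => ‖iteratedFDeriv ℝ i b x‖) (fun i => by
      obtain ⟨M, hM⟩ := (b.hasCompactSupport.iteratedFDeriv (𝕜 := ℝ) i).exists_bound_of_continuous
        ((bsmooth i).continuous_iteratedFDeriv le_rfl)
      exact ⟨M, fun x _ => hM x⟩) 2
  have hsm : ∀ i : ℕ, ContDiff ℝ i Real.smoothTransition := fun i =>
    Real.smoothTransition.contDiff (n := (i : ℕ∞))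
  obtain ⟨H, hH1, hH⟩ := exists_uniform_bound (s := Set.Icc (0:ℝ) (110 ^ d))
    (a := fun i t => ‖iteratedFDeriv ℝ i Real.smoothTransition t‖) (fun i =>
      isCompact_Icc.exists_bound_of_continuousOn
        ((hsm i).continuous_iteratedFDeriv le_rfl).continuousOn) 2
  set N : ℝ := 110 ^ d with hN
  have hN1 : 1 ≤ N := one_le_pow₀ (by norm_num)
  refine ⟨d * (2 * H * (N * B * 110) ^ 2) + 1, by positivity, ?_⟩
  intro R hR hpos K hK
  obtain ⟨J, hJK, hdisj, hcov⟩ := exists_disjoint_cover hpos hR.continuous hK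
  let k : EuclideanSpace ℝ (Fin d) → EuclideanSpace ℝ (Fin d) → ℝ :=
    fun y z => b ((R y / 100)⁻¹ • (z - y))
  have hr : ∀ y, 0 < R y / 100 := fun y => by have := hpos y; positivity
  have hnorm : ∀ y z, dist ((R y / 100)⁻¹ • (z - y)) 0 = dist z y / (R y / 100) := fun y z => by
    rw [dist_zero_right, norm_smul, norm_inv, Real.norm_of_nonneg (hr y).le, dist_eq_norm]
    ring
  have kone : ∀ y z, dist z y ≤ R y / 20 → k y z = 1 := by
    intro y z hz
    refine b.one_of_mem_closedBall ?_
    rw [Metric.mem_closedBall, hnorm, div_le_iff₀ (hr y)]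
    change _ ≤ 5 * _
    linarith
  have kzero : ∀ y z, R y / 10 < dist z y → k y z = 0 := by
    intro y z hz
    refine b.zero_of_le_dist ?_
    rw [hnorm, le_div_iff₀ (hr y)]
    change 10 * _ ≤ _
    linarith
  have knonneg : ∀ y z, 0 ≤ k y z := fun y z => b.nonneg
  have kle : ∀ y z, k y z ≤ 1 := fun y z => b.le_one
  have ksmooth : ∀ (i : ℕ) y, ContDiff ℝ i (k y) := fun i y =>
    (bsmooth i).comp ((contDiff_id.sub contDiff_const).const_smul _)
  have kder : ∀ i ≤ 2, ∀ y z,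
      ‖iteratedFDeriv ℝ i (k y) z‖ ≤ if dist z y ≤ R y / 10 then (110 / R z) ^ i * B else 0 := by
    intro i hi y z
    split_ifs with h
    · refine (norm_iteratedFDeriv_comp_inv_smul_sub (bsmooth i) (hr y)
        (fun w => hB i hi w trivial) z y).trans ?_
      have h1 := hR.le_add_dist z y
      have hz := hpos z
      have hy := hpos y
      gcongr
      rw [inv_div, div_le_div_iff₀ hy hz]
      linarith
    · have h0 : k y =ᶠ[nhds z] fun _ => 0 := by
        filter_upwards [(isOpen_lt continuous_const (continuous_id.dist continuous_const)).mem_nhds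
          (not_le.mp h)] with w hw using kzero y w hw
      rw [(h0.iteratedFDeriv ℝ i).self_of_nhds]
      simp
  let S : EuclideanSpace ℝ (Fin d) → ℝ := fun z => ∑ y ∈ J, k y z
  have Ssmooth : ∀ i : ℕ, ContDiff ℝ i S := fun i => ContDiff.sum fun y _ => ksmooth i y
  have Snonneg : ∀ z, 0 ≤ S z := fun z => Finset.sum_nonneg fun y _ => knonneg y z
  have Sge : ∀ y ∈ J, ∀ z, dist z y ≤ R y / 20 → 1 ≤ S z := fun y hy z hz =>
    (kone y z hz).symm.trans_le
      (Finset.single_le_sum (f := fun y => k y z) (fun y _ => knonneg y z) hy)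
  have hcard := card_filter_dist_le hR hpos hdisj
  have Sle : ∀ z, S z ≤ N := by
    intro z
    refine le_trans (Finset.sum_le_sum (g := fun y => if dist z y ≤ R y / 10 then 1 else 0) ?_) ?_
    · intro y _
      split_ifs with h
      · exact kle y z
      · exact (kzero y z (not_le.mp h)).le
    · simpa [Finset.sum_ite] using hcard z
  have Sder : ∀ z, ∀ i, 1 ≤ i → i ≤ 2 →
      ‖iteratedFDeriv ℝ i S z‖ ≤ (N * B * 110 / R z) ^ i := by
    intro z i hi1 hi2
    have hz := hpos z
    have e : iteratedFDeriv ℝ i S z = ∑ y ∈ J, iteratedFDeriv ℝ i (k y) z := by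
      rw [iteratedFDeriv_sum fun y _ => ksmooth i y, Finset.sum_apply]
    rw [e]
    calc ‖∑ y ∈ J, iteratedFDeriv ℝ i (k y) z‖
        ≤ ∑ y ∈ J, if dist z y ≤ R y / 10 then (110 / R z) ^ i * B else 0 :=
          norm_sum_le_of_le _ fun y _ => kder i hi2 y z
      _ = (J.filter fun y => dist z y ≤ R y / 10).card * ((110 / R z) ^ i * B) := by
          simp [Finset.sum_ite]
      _ ≤ N * ((110 / R z) ^ i * B) := by gcongr; exact hcard z
      _ = (N * B) * (110 / R z) ^ i := by ring
      _ ≤ (N * B) ^ i * (110 / R z) ^ i := by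
          gcongr
          exact le_self_pow₀ (one_le_mul_of_one_le_of_one_le hN1 hB1) (by omega)
      _ = (N * B * 110 / R z) ^ i := by rw [← mul_pow]; ring
  have χone : ∀ y ∈ J, ∀ z, dist z y ≤ R y / 20 → Real.smoothTransition (S z) = 1 :=
    fun y hy z hz => Real.smoothTransition.one_of_one_le (Sge y hy z hz)
  refine ⟨J, Real.smoothTransition ∘ S, hJK, hdisj, (hsm 2).comp (Ssmooth 2),
    fun z => Real.smoothTransition.nonneg _, fun z => Real.smoothTransition.le_one _,
    ?_, ?_, ?_, ?_⟩
  · intro x hx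
    obtain ⟨y, hy, hxy⟩ := hcov x hx
    filter_upwards [hxy] with z hz using χone y hy z hz
  · intro y hy z hz
    refine χone y hy z (le_trans hz ?_)
    linarith [hr y]
  · intro z
    contrapose!
    intro h
    have : S z = 0 := Finset.sum_eq_zero fun y hy => kzero y z (h y hy)
    simp [this]
  · intro z
    have hz := hpos z
    have h1 := norm_iteratedFDeriv_comp_le (n := 2) (hsm 2) (Ssmooth 2) le_rfl z
      (fun i hi => hH i hi (S z) ⟨Snonneg z, Sle z⟩) (Sder z)
    have h2 := (abs_lap_le (f := Real.smoothTransition ∘ S) z).trans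
      (mul_le_mul_of_nonneg_left h1 (Nat.cast_nonneg d))
    calc |lap (Real.smoothTransition ∘ S) z| * R z ^ 2
        ≤ (d * ((Nat.factorial 2 : ℕ) * H * (N * B * 110 / R z) ^ 2)) * R z ^ 2 := by gcongr
      _ = d * (2 * H * (N * B * 110) ^ 2) := by
          simp only [Nat.factorial_two, Nat.cast_ofNat]
          field_simp
      _ ≤ _ := by linarith

end Cutoff

section MainLemma

variable {d : ℕ}

theorem measureReal_biUnion_closedBall_mul_le {R : EuclideanSpace ℝ (Fin d) → ℝ}
    (hpos : ∀ x, 0 < R x) {J : Finset (EuclideanSpace ℝ (Fin d))}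
    (hdisj : (J : Set (EuclideanSpace ℝ (Fin d))).PairwiseDisjoint
      fun y => Metric.closedBall y (R y / 100)) :
    volume.real (⋃ y ∈ J, Metric.closedBall y (R y / 10))
      ≤ 10 ^ d * volume.real (⋃ y ∈ J, Metric.closedBall y (R y / 100)) := by
  rw [measureReal_biUnion_finset hdisj (fun _ _ => measurableSet_closedBall)
    fun _ _ => measure_closedBall_lt_top.ne, Finset.mul_sum]
  refine (measureReal_biUnion_finset_le _ _).trans (Finset.sum_le_sum fun y _ => ?_)
  have hy := hpos y
  rw [Measure.addHaar_real_closedBall volume y (by positivity),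
    Measure.addHaar_real_closedBall volume y (by positivity), finrank_euclideanSpace_fin,
    ← mul_assoc, ← mul_pow]
  apply le_of_eq
  congr 2
  ring

theorem abs_integral_lap_mul_le {u φ : EuclideanSpace ℝ (Fin d) → ℝ} {S : Set _} {a : ℝ}
    (hS : IsCompact S) (hφ : ∀ x ∉ S, lap φ x = 0) (h : ∀ x, |lap φ x * u x| ≤ a) :
    |∫ x, lap φ x * u x| ≤ a * volume.real S := by
  rw [← setIntegral_eq_integral_of_forall_compl_eq_zero (s := S)
    fun x hx => by rw [hφ x hx, zero_mul]]
  exact norm_setIntegral_le_of_norm_le_const (f := fun x => lap φ x * u x) hS.measure_lt_top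
    fun x _ => h x

/-- The inner and outer test functions: `φ` is one on `U` and vanishes on `D`,
while `ψ` is one on both `U` and `D`. -/
theorem exists_test_functions (d : ℕ) :
    ∃ c : ℝ, 0 < c ∧ ∀ u R : EuclideanSpace ℝ (Fin d) → ℝ, LipschitzWith 1 R → (∀ x, 0 < R x) →
      (∀ x, |u x| ≤ c * R x ^ 2) → ∀ U : Set (EuclideanSpace ℝ (Fin d)), IsCompact U →
      ∃ (D : Set (EuclideanSpace ℝ (Fin d))) (φ ψ : EuclideanSpace ℝ (Fin d) → ℝ),
        IsCompact D ∧ Disjoint U D ∧ D ⊆ nbhd R U 4 ∧ U ⊆ nbhd R U 4 ∧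
        ContDiff ℝ 2 φ ∧ ContDiff ℝ 2 ψ ∧
        (∀ x, 0 ≤ φ x ∧ φ x ≤ 1) ∧ (∀ x, 0 ≤ ψ x ∧ ψ x ≤ 1) ∧
        (∀ x ∉ nbhd R U 4, φ x = 0 ∧ ψ x = 0) ∧
        (∀ x ∈ U, φ x = 1 ∧ ψ x = 1) ∧ (∀ x ∈ D, φ x = 0 ∧ ψ x = 1) ∧
        |∫ x, lap φ x * u x| ≤ volume.real D ∧ |∫ x, lap ψ x * u x| ≤ volume.real D := by
  classical
  obtain ⟨C, hC, hcut⟩ := exists_cutoff_s7 d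
  refine ⟨1 / (C * 10 ^ d), by positivity, ?_⟩
  intro u R hR hpos hu U hU
  set O : Set (EuclideanSpace ℝ (Fin d)) := ⋃ x ∈ U, Metric.ball x (R x / 2) with hO
  have Oopen : IsOpen O := isOpen_biUnion fun _ _ => Metric.isOpen_ball
  have near : ∀ w ∈ U, ∀ z, dist z w ≤ 4 / 5 * R w → z ∈ nbhd R U 4 := fun w hw z hz =>
    ⟨w, hw, specialDist_le_of_dist_le hR hpos hz⟩
  have UO : U ⊆ O := fun x hx =>
    Set.mem_iUnion₂.mpr ⟨x, hx, Metric.mem_ball_self (by have := hpos x; positivity)⟩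
  have ON : O ⊆ nbhd R U 4 := by
    intro z hz
    obtain ⟨w, hw, hzw⟩ := Set.mem_iUnion₂.mp hz
    have := hpos w
    exact near w hw z ((Metric.mem_ball.mp hzw).le.trans (by linarith))
  have hKc : IsCompact (frontier O) :=
    Metric.isCompact_of_isClosed_isBounded isClosed_frontier
      (((isBounded_nbhd hR hpos hU 4).subset ON).closure.subset frontier_subset_closure)
  obtain ⟨J, χ, hJK, hdisj, χsmooth, χ0, χ1, χK, χJ, χsupp, χlap⟩ := hcut R hR hpos _ hKc
  set D := ⋃ y ∈ J, Metric.closedBall y (R y / 100) with hD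
  set E := ⋃ y ∈ J, Metric.closedBall y (R y / 10) with hE
  have Dc : IsCompact D := J.isCompact_biUnion fun _ _ => isCompact_closedBall _ _
  have Ec : IsCompact E := J.isCompact_biUnion fun _ _ => isCompact_closedBall _ _
  have DE : D ⊆ E := Set.iUnion₂_mono fun y _ =>
    Metric.closedBall_subset_closedBall (by linarith [hpos y])
  have χD : ∀ x ∈ D, χ x = 1 := by
    intro x hx
    obtain ⟨y, hy, hxy⟩ := Set.mem_iUnion₂.mp hx
    exact χJ y hy x hxy
  have χE : ∀ x ∉ E, χ x = 0 := by
    intro x hx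
    by_contra h
    obtain ⟨y, hy, hxy⟩ := χsupp x h
    exact hx (Set.mem_iUnion₂.mpr ⟨y, hy, hxy⟩)
  have lapχ : ∀ x ∉ E, lap χ x = 0 := by
    intro x hx
    rw [← lap_const 0 x]
    refine lap_congr ?_
    filter_upwards [Ec.isClosed.isOpen_compl.mem_nhds hx] with z hz using χE z hz
  have EN : E ⊆ nbhd R U 4 := by
    intro p hp
    obtain ⟨y, hy, hpy⟩ := Set.mem_iUnion₂.mp hp
    obtain ⟨z, hz, hyz⟩ := Metric.mem_closure_iff.mp (frontier_subset_closure (hJK hy))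
      (R y / 100) (by have := hpos y; positivity)
    obtain ⟨w, hw, hzw⟩ := Set.mem_iUnion₂.mp hz
    refine near w hw p ?_
    rw [Metric.mem_closedBall] at hpy
    rw [Metric.mem_ball] at hzw
    have t1 := hR.le_add_dist y w
    have t2 := dist_triangle y z w
    have t3 := dist_triangle p y w
    have := hpos w
    linarith
  have UE : ∀ x ∈ U, x ∉ E := by
    intro x hx hxD
    obtain ⟨y, hy, hxy⟩ := Set.mem_iUnion₂.mp hxD
    have hyO : y ∉ O := fun h => by
      have := hJK hy
      rw [frontier, Oopen.interior_eq] at this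
      exact this.2 h
    refine hyO (Set.mem_iUnion₂.mpr ⟨x, hx, ?_⟩)
    rw [Metric.mem_closedBall] at hxy
    have t1 := hR.le_add_dist y x
    have := hpos x
    rw [Metric.mem_ball]
    rw [dist_comm] at hxy
    linarith
  set φ : EuclideanSpace ℝ (Fin d) → ℝ := O.indicator fun x => 1 - χ x with hφ
  set ψ : EuclideanSpace ℝ (Fin d) → ℝ := fun x => φ x + χ x with hψ
  have φO : ∀ x ∈ O, φ x = 1 - χ x := fun x hx => Set.indicator_of_mem hx _
  have φnO : ∀ x ∉ O, φ x = 0 := fun x hx => Set.indicator_of_notMem hx _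
  have φcases : ∀ x, (φ =ᶠ[nhds x] fun z => 1 - χ z) ∨ (φ =ᶠ[nhds x] fun _ => 0) := by
    intro x
    by_cases hx : x ∈ O
    · left
      filter_upwards [Oopen.mem_nhds hx] with z hz using φO z hz
    · right
      by_cases hxc : x ∈ closure O
      · have hxK : x ∈ frontier O := by rw [frontier, Oopen.interior_eq]; exact ⟨hxc, hx⟩
        filter_upwards [χK x hxK] with z hz
        by_cases hzO : z ∈ O
        · rw [φO z hzO, hz, sub_self]
        · exact φnO z hzO
      · filter_upwards [isClosed_closure.isOpen_compl.mem_nhds hxc] with z hz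
          using φnO z fun h => hz (subset_closure h)
  have φsmooth : ContDiff ℝ 2 φ := by
    rw [contDiff_iff_contDiffAt]
    intro x
    rcases φcases x with h | h
    · exact (contDiff_const.sub χsmooth).contDiffAt.congr_of_eventuallyEq h
    · exact contDiffAt_const.congr_of_eventuallyEq h
  have lapφ : ∀ x, |lap φ x| ≤ |lap χ x| := by
    intro x
    rcases φcases x with h | h
    · rw [lap_congr h, lap_const_sub, abs_neg]
    · rw [lap_congr h, lap_const, abs_zero]
      exact abs_nonneg _
  have lapψ : ∀ x, |lap ψ x| ≤ |lap χ x| := by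
    intro x
    rcases φcases x with h | h
    · have : ψ =ᶠ[nhds x] fun _ => 1 := by
        filter_upwards [h] with z hz
        simp only [hψ, hz, sub_add_cancel]
      rw [lap_congr this, lap_const, abs_zero]
      exact abs_nonneg _
    · have : ψ =ᶠ[nhds x] χ := by
        filter_upwards [h] with z hz
        simp only [hψ, hz, zero_add]
      rw [lap_congr this]
  have bound : ∀ f : EuclideanSpace ℝ (Fin d) → ℝ, (∀ x, |lap f x| ≤ |lap χ x|) →
      |∫ x, lap f x * u x| ≤ volume.real D := by
    intro f hf
    have h1 : ∀ x, |lap f x * u x| ≤ 1 / 10 ^ d := by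
      intro x
      rw [abs_mul]
      calc |lap f x| * |u x| ≤ |lap χ x| * (1 / (C * 10 ^ d) * R x ^ 2) :=
            mul_le_mul (hf x) (hu x) (abs_nonneg _) (abs_nonneg _)
        _ = (|lap χ x| * R x ^ 2) * (1 / (C * 10 ^ d)) := by ring
        _ ≤ C * (1 / (C * 10 ^ d)) := by gcongr; exact χlap x
        _ = 1 / 10 ^ d := by field_simp
    have h2 : ∀ x ∉ E, lap f x = 0 := fun x hx => by
      have := hf x
      rw [lapχ x hx, abs_zero] at this
      exact abs_nonpos_iff.mp this
    refine (abs_integral_lap_mul_le Ec h2 h1).trans ?_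
    rw [one_div, inv_mul_le_iff₀ (by positivity)]
    exact measureReal_biUnion_closedBall_mul_le hpos hdisj
  have χU : ∀ x ∈ U, χ x = 0 := fun x hx => χE x (UE x hx)
  refine ⟨D, φ, ψ, Dc, Set.disjoint_left.mpr fun x hx hxD => UE x hx (DE hxD),
    DE.trans EN, UO.trans ON, φsmooth, φsmooth.add χsmooth, ?_, ?_, ?_, ?_, ?_,
    bound φ lapφ, bound ψ lapψ⟩
  · intro x
    by_cases hx : x ∈ O
    · rw [φO x hx]; constructor <;> linarith [χ0 x, χ1 x]
    · rw [φnO x hx]; exact ⟨le_rfl, zero_le_one⟩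
  · intro x
    simp only [hψ]
    by_cases hx : x ∈ O
    · rw [φO x hx]; constructor <;> linarith [χ0 x, χ1 x]
    · rw [φnO x hx, zero_add]; exact ⟨χ0 x, χ1 x⟩
  · intro x hx
    simp only [hψ]
    rw [φnO x fun h => hx (ON h), χE x fun h => hx (EN h)]
    simp
  · intro x hx
    simp only [hψ]
    rw [φO x (UO hx), χU x hx]
    simp
  · intro x hx
    have : φ x = 0 := by
      by_cases hxO : x ∈ O
      · rw [φO x hxO, χD x hx, sub_self]
      · exact φnO x hxO
    simp only [hψ]
    rw [this, χD x hx]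
    simp

theorem integral_mul_lap_add_one {u φ : EuclideanSpace ℝ (Fin d) → ℝ} (hu : ContDiff ℝ 2 u)
    (hφ : ContDiff ℝ 2 φ) (hc : HasCompactSupport φ) :
    Integrable φ ∧ Integrable (fun x => φ x * (lap u x + 1)) ∧
      ∫ x, φ x * (lap u x + 1) = (∫ x, lap φ x * u x) + ∫ x, φ x := by
  have hl := hu.continuous_lap
  have hφc := hφ.continuous
  have i1 : Integrable φ := hφc.integrable_of_hasCompactSupport hc
  have i2 : Integrable fun x => φ x * lap u x :=
    (hφc.mul hl).integrable_of_hasCompactSupport hc.mul_right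
  refine ⟨i1, ?_, ?_⟩
  · simp only [mul_add, mul_one]
    exact i2.add i1
  · simp only [mul_add, mul_one]
    rw [integral_add i2 i1, integral_mul_lap hφ hu hc]

end MainLemma

/-- Main Lemma: there is `c > 0` depending only on `d` such that if a C²
function `u` and a special metric `ρ` (corresponding to a positive 1-Lipschitz `R`)
satisfy `|u(x)| ≤ c R(x)²` and `Δu(x) ≥ −1` for all `x`, then for every compact `U`:
`∫_U Δu dm ≤ m(U_{+4} \ U)` and `−∫_{U_{+4}} Δu dm ≤ m(U_{+4} \ U)`. -/
theorem stmt_7 (d : ℕ) :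
    ∃ c : ℝ, 0 < c ∧
    ∀ u R : EuclideanSpace ℝ (Fin d) → ℝ,
      ContDiff ℝ 2 u → LipschitzWith 1 R → (∀ x, 0 < R x) →
      (∀ x, |u x| ≤ c * R x ^ 2) → (∀ x, -1 ≤ lap u x) →
      ∀ U : Set (EuclideanSpace ℝ (Fin d)), IsCompact U →
        (∫ x in U, lap u x ≤ (volume (nbhd R U 4 \ U)).toReal) ∧
        (-∫ x in nbhd R U 4, lap u x ≤ (volume (nbhd R U 4 \ U)).toReal) := by
  obtain ⟨c, hc, h⟩ := exists_test_functions d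
  refine ⟨c, hc, fun u R hu hR hpos hbound hlap U hU => ?_⟩
  obtain ⟨D, φ, ψ, Dc, UD, DN, UN, φs, ψs, φ01, ψ01, hN, hφψU, hφψD, Iφ, Iψ⟩ :=
    h u R hR hpos hbound U hU
  have bdd := isBounded_nbhd hR hpos hU 4
  have fin : volume (nbhd R U 4) ≠ ⊤ := bdd.measure_lt_top.ne
  have compact {f : EuclideanSpace ℝ (Fin d) → ℝ} (hf : ∀ x ∉ nbhd R U 4, f x = 0) :
      HasCompactSupport f :=
    HasCompactSupport.of_support_subset_isCompact bdd.isCompact_closure fun x hx =>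
      subset_closure (by_contra fun hx' => hx (hf x hx'))
  obtain ⟨φi, φli, φeq⟩ := integral_mul_lap_add_one hu φs (compact fun x hx => (hN x hx).1)
  obtain ⟨ψi, ψli, ψeq⟩ := integral_mul_lap_add_one hu ψs (compact fun x hx => (hN x hx).2)
  set V := toMeasurable volume (nbhd R U 4) with hV
  have Vm : MeasurableSet V := measurableSet_toMeasurable _ _
  have Um : MeasurableSet U := hU.measurableSet
  have Dm : MeasurableSet D := Dc.measurableSet
  have NV : nbhd R U 4 ⊆ V := subset_toMeasurable _ _
  have Vvol : volume V = volume (nbhd R U 4) := measure_toMeasurable _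
  have Vfin : volume V ≠ ⊤ := Vvol ▸ fin
  have hdiff : (volume (nbhd R U 4 \ U)).toReal = volume.real V - volume.real U := by
    rw [measure_sdiff UN Um.nullMeasurableSet hU.measure_lt_top.ne, ← Vvol,
      ENNReal.toReal_sub_of_le (measure_mono (UN.trans NV)) Vfin]
    rfl
  have nonneg1 : ∀ x, 0 ≤ lap u x + 1 := fun x => by linarith [hlap x]
  have lapN : IntegrableOn (lap u) (nbhd R U 4) :=
    (hu.continuous_lap.continuousOn.integrableOn_compact bdd.isCompact_closure).mono_set
      subset_closure
  have lapV : IntegrableOn (lap u) V := by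
    rw [IntegrableOn, hV, Measure.restrict_toMeasurable fin]; exact lapN
  have lapU : IntegrableOn (lap u) U := lapN.mono_set UN
  have one_int {s : Set (EuclideanSpace ℝ (Fin d))} (hs : volume s ≠ ⊤) :
      IntegrableOn (fun _ => (1:ℝ)) s := integrableOn_const hs
  have split {s : Set (EuclideanSpace ℝ (Fin d))} (hs : volume s ≠ ⊤)
      (hl : IntegrableOn (lap u) s) :
      ∫ x in s, (lap u x + 1) = (∫ x in s, lap u x) + volume.real s := by
    rw [integral_add hl (one_int hs)]; simp
  have Ufin : volume U ≠ ⊤ := hU.measure_lt_top.ne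
  have Dfin : volume D ≠ ⊤ := Dc.measure_lt_top.ne
  constructor
  · have e1 : ∫ x in U, (lap u x + 1) ≤ ∫ x, φ x * (lap u x + 1) := by
      rw [← integral_indicator Um]
      refine integral_mono ((lapU.add (one_int Ufin)).integrable_indicator Um) φli fun x => ?_
      by_cases hx : x ∈ U
      · simp [hx, (hφψU x hx).1]
      · simpa [hx] using mul_nonneg (φ01 x).1 (nonneg1 x)
    have e2 : (∫ x, φ x) + volume.real D ≤ volume.real V := by
      rw [← integral_indicator_one Dm, ← integral_indicator_one Vm]
      have iD : Integrable (D.indicator (1 : EuclideanSpace ℝ (Fin d) → ℝ)) :=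
        (one_int Dfin).integrable_indicator Dm
      rw [← integral_add φi iD]
      refine integral_mono (φi.add iD) ((one_int Vfin).integrable_indicator Vm) fun x => ?_
      by_cases hx : x ∈ D
      · simp [hx, (hφψD x hx).1, NV (DN hx)]
      · by_cases hxV : x ∈ V
        · simpa [hx, hxV] using (φ01 x).2
        · simp [hx, hxV, (hN x fun hxN => hxV (NV hxN)).1]
    rw [split Ufin lapU] at e1
    rw [hdiff]
    linarith [(abs_le.mp Iφ).2]
  · have e1 : ∫ x, ψ x * (lap u x + 1) ≤ ∫ x in V, (lap u x + 1) := by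
      rw [← integral_indicator Vm]
      refine integral_mono ψli ((lapV.add (one_int Vfin)).integrable_indicator Vm) fun x => ?_
      by_cases hx : x ∈ V
      · simpa [hx] using mul_le_of_le_one_left (nonneg1 x) (ψ01 x).2
      · simp [hx, (hN x fun hxN => hx (NV hxN)).2]
    have e2 : volume.real U + volume.real D ≤ ∫ x, ψ x := by
      rw [← measureReal_union UD Dm, ← integral_indicator_one (Um.union Dm)]
      refine integral_mono ((one_int (measure_union_ne_top Ufin Dfin)).integrable_indicator
        (Um.union Dm)) ψi fun x => ?_
      by_cases hx : x ∈ U ∪ D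
      · rw [Set.indicator_of_mem hx]
        rcases hx with hx | hx
        · exact (hφψU x hx).2.ge
        · exact (hφψD x hx).2.ge
      · rw [Set.indicator_of_notMem hx]
        exact (ψ01 x).1
    rw [split Vfin lapV] at e1
    rw [hdiff, ← Measure.restrict_toMeasurable fin]
    linarith [(abs_le.mp Iψ).1]
end

section
/- Let η : ℝ^d × Ω → [0,∞) be a measurable random process on a probability space (Ω, F, P) satisfying E exp(c·η(x)) ≤ C for some constants c, C ∈ (0,∞) and all x ∈ ℝ^d. Fix a compactly supported smooth function χ : ℝ^d → [0,∞) with ∫χ dm = 1, and a constant K > 0. Define R(x) = max_y ( √(K·(1 + (η*χ)(y))) − |y − x| ). Then there exist constants c₁, C₁ > 0 (depending on c, C, K, d, χ) such that E exp(c₁·R(x)²) ≤ C₁ for all x ∈ ℝ^d. -/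
open MeasureTheory Real

/-- A form of Jensen's inequality for the exponential, valid without integrability of `f * w`
because of the additional summand `1`. -/
lemma ofReal_exp_integral_mul_le {α : Type*} [MeasurableSpace α] {μ : Measure α}
    {f w : α → ℝ} (hf : Measurable f) (hw : Measurable w) (hw0 : ∀ z, 0 ≤ w z)
    (hwi : Integrable w μ) (hw1 : ∫ z, w z ∂μ = 1) :
    ENNReal.ofReal (exp (∫ z, f z * w z ∂μ)) ≤
      1 + ∫⁻ z, ENNReal.ofReal (w z * exp (f z)) ∂μ := by
  by_cases hint : Integrable (fun z => f z * w z) μ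
  swap
  · simp [integral_undef hint]
  by_cases htop : ∫⁻ z, ENNReal.ofReal (w z * exp (f z)) ∂μ = ⊤
  · simp [htop]
  have hnn : ∀ z, 0 ≤ w z * exp (f z) := fun z => mul_nonneg (hw0 z) (exp_pos _).le
  have hm : Measurable fun z => w z * exp (f z) := by fun_prop
  have hi : Integrable (fun z => w z * exp (f z)) μ :=
    ⟨hm.aestronglyMeasurable, by
      rw [hasFiniteIntegral_iff_ofReal (Filter.Eventually.of_forall hnn)]
      exact lt_top_iff_ne_top.2 htop⟩
  refine le_trans ?_ le_add_self
  rw [← ofReal_integral_eq_lintegral_ofReal hi (Filter.Eventually.of_forall hnn)]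
  refine ENNReal.ofReal_le_ofReal ?_
  set S := ∫ z, f z * w z ∂μ with hS
  have htangent : ∫ z, (exp S * (1 - S) * w z + exp S * (f z * w z)) ∂μ = exp S := by
    rw [integral_add (hwi.const_mul _) (hint.const_mul _), integral_const_mul,
      integral_const_mul, hw1, ← hS]
    ring
  rw [← htangent]
  refine integral_mono ((hwi.const_mul _).add (hint.const_mul _)) hi fun z => ?_
  have h := mul_le_mul_of_nonneg_left (add_one_le_exp (f z - S)) (exp_pos S).le
  rw [← exp_add, add_sub_cancel] at h
  have h' := mul_le_mul_of_nonneg_left h (hw0 z)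
  dsimp only
  linarith

/-- The exponential of the square of a supremum of reals is controlled by a common bound. -/
lemma ofReal_exp_mul_iSup_sq_le {ι : Type*} (g : ι → ℝ) (i₀ : ι) (hi₀ : 0 ≤ g i₀)
    {a : ℝ} (ha : 0 < a) {B : ENNReal}
    (hB : ∀ i, 0 ≤ g i → ENNReal.ofReal (exp (a * g i ^ 2)) ≤ B) :
    ENNReal.ofReal (exp (a * (⨆ i, g i) ^ 2)) ≤ B := by
  have : Nonempty ι := ⟨i₀⟩
  by_cases htop : B = ⊤
  · simp [htop]
  have hpos : 0 < B.toReal := by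
    refine (exp_pos (a * g i₀ ^ 2)).trans_le ?_
    exact (ENNReal.ofReal_le_iff_le_toReal htop).1 (hB i₀ hi₀)
  have hle : ∀ i, g i ≤ √(log B.toReal / a) := by
    intro i
    by_cases hi : 0 ≤ g i
    · refine le_sqrt_of_sq_le ?_
      rw [le_div_iff₀ ha, le_log_iff_exp_le hpos, mul_comm]
      exact (ENNReal.ofReal_le_iff_le_toReal htop).1 (hB i hi)
    · exact (not_le.1 hi).le.trans (sqrt_nonneg _)
  have hlog : 0 ≤ log B.toReal / a := by
    refine div_nonneg ?_ ha.le
    have h : a * g i₀ ^ 2 ≤ log B.toReal := by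
      rw [le_log_iff_exp_le hpos]
      exact (ENNReal.ofReal_le_iff_le_toReal htop).1 (hB i₀ hi₀)
    exact (by positivity : 0 ≤ a * g i₀ ^ 2).trans h
  have hbdd : BddAbove (Set.range g) := ⟨_, Set.forall_mem_range.2 hle⟩
  have h0 : 0 ≤ ⨆ i, g i := hi₀.trans (le_ciSup hbdd i₀)
  have h1 : (⨆ i, g i) ^ 2 ≤ log B.toReal / a := by
    rw [← sq_sqrt hlog]
    exact pow_le_pow_left₀ h0 (ciSup_le hle) 2
  rw [ENNReal.ofReal_le_iff_le_toReal htop, ← le_log_iff_exp_le hpos, mul_comm]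
  exact (le_div_iff₀ ha).1 h1

/-- A bounded function supported in a ball, damped by a Gaussian of the distance from `x` to the
centre of the ball, is dominated by a wider Gaussian. -/
lemma mul_exp_neg_sq_norm_le {E : Type*} [NormedAddCommGroup E] {χ : E → ℝ} {M r : ℝ}
    (hM0 : 0 ≤ M) (hM : ∀ z, χ z ≤ M) (hr : ∀ z, χ z ≠ 0 → ‖z‖ ≤ r) {a : ℝ} (ha : 0 ≤ a)
    (x y z : E) :
    χ (y - z) * exp (-a * ‖y - x‖ ^ 2) ≤
      M * exp (a * r ^ 2) * exp (-(a / 2) * ‖z - x‖ ^ 2) := by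
  by_cases h0 : χ (y - z) = 0
  · rw [h0, zero_mul]
    positivity
  have hyz := hr _ h0
  have htri : ‖z - x‖ ≤ ‖y - x‖ + r := by
    have h := norm_sub_le (y - x) (y - z)
    rw [sub_sub_sub_cancel_left] at h
    linarith
  have hsq : ‖z - x‖ ^ 2 ≤ 2 * (‖y - x‖ ^ 2 + r ^ 2) := by
    have := pow_le_pow_left₀ (norm_nonneg _) htri 2
    nlinarith [sq_nonneg (‖y - x‖ - r)]
  rw [mul_assoc, ← exp_add]
  refine mul_le_mul (hM _) (exp_le_exp.2 ?_) (exp_pos _).le hM0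
  nlinarith

/-- Lemma 5.1: if a nonnegative random process `η` satisfies
`E exp(c η(x)) ≤ C` for all `x`, and `R(x) = max_y (√(K(1 + (η*χ)(y))) − |y − x|)`
(`χ` a fixed smooth compactly supported probability density, `K > 0`), then
`E exp(c₁ R(x)²) ≤ C₁` for all `x`, for some constants `c₁, C₁ > 0`. -/
theorem stmt_8 {d : ℕ} {Ω : Type*} [MeasurableSpace Ω] (P : Measure Ω) [IsProbabilityMeasure P]
    (η : EuclideanSpace ℝ (Fin d) → Ω → ℝ)
    (hmeas : Measurable (fun p : EuclideanSpace ℝ (Fin d) × Ω => η p.1 p.2))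
    (hnonneg : ∀ x ω, 0 ≤ η x ω)
    (c C : ℝ) (hc : 0 < c) (hC : 0 < C)
    (hexp : ∀ x, ∫⁻ ω, ENNReal.ofReal (Real.exp (c * η x ω)) ∂P ≤ ENNReal.ofReal C)
    (χ : EuclideanSpace ℝ (Fin d) → ℝ) (hχsmooth : ContDiff ℝ (⊤ : ℕ∞) χ)
    (hχsupp : HasCompactSupport χ) (hχnonneg : ∀ z, 0 ≤ χ z)
    (hχint : ∫ z, χ z = 1)
    (K : ℝ) (hK : 0 < K)
    (R : EuclideanSpace ℝ (Fin d) → Ω → ℝ)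
    (hR : ∀ x ω, R x ω =
      ⨆ y : EuclideanSpace ℝ (Fin d),
        (Real.sqrt (K * (1 + ∫ z, η z ω * χ (y - z))) - ‖y - x‖)) :
    ∃ c₁ C₁ : ℝ, 0 < c₁ ∧ 0 < C₁ ∧
      ∀ x, ∫⁻ ω, ENNReal.ofReal (Real.exp (c₁ * (R x ω) ^ 2)) ∂P ≤ ENNReal.ofReal C₁ := by
  obtain ⟨M, hM⟩ := hχsupp.exists_bound_of_continuous hχsmooth.continuous
  replace hM : ∀ z, χ z ≤ M := fun z => (le_abs_self _).trans (hM z)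
  have hM0 : 0 ≤ M := (hχnonneg 0).trans (hM 0)
  obtain ⟨r, hr⟩ := hχsupp.isCompact.isBounded.exists_norm_le
  replace hr : ∀ z, χ z ≠ 0 → ‖z‖ ≤ r := fun z hz => hr z (subset_tsupport _ hz)
  have hχi : Integrable χ := hχsmooth.continuous.integrable_of_hasCompactSupport hχsupp
  have hχm : Measurable χ := hχsmooth.continuous.measurable
  set a : ℝ := c / K with ha_def
  have ha : 0 < a := div_pos hc hK
  have haK : a * K = c := div_mul_cancel₀ c hK.ne'
  set A : ℝ := M * exp (a * r ^ 2) with hA_def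
  have hA : 0 ≤ A := by positivity
  set γ : EuclideanSpace ℝ (Fin d) → ℝ := fun z => exp (-(a / 2) * ‖z‖ ^ 2) with hγ_def
  have hγm : Measurable γ := by fun_prop
  have hγi : Integrable γ := by
    refine not_imp_comm.1 integral_undef (ne_of_gt ?_)
    rw [hγ_def, GaussianFourier.integral_rexp_neg_mul_sq_norm (half_pos ha)]
    positivity
  set G : EuclideanSpace ℝ (Fin d) → Ω → ENNReal := fun x ω =>
    ∫⁻ z, ENNReal.ofReal (γ (z - x)) * ENNReal.ofReal (exp (c * η z ω)) with hG_def
  have hGE : ∀ x, ∫⁻ ω, G x ω ∂P ≤ ENNReal.ofReal ((∫ z, γ z) * C) := by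
    intro x
    have hswap : ∫⁻ ω, G x ω ∂P = ∫⁻ z, ∫⁻ ω,
        ENNReal.ofReal (γ (z - x)) * ENNReal.ofReal (exp (c * η z ω)) ∂P := by
      refine lintegral_lintegral_swap (Measurable.aemeasurable ?_)
      have h : Measurable fun p : Ω × EuclideanSpace ℝ (Fin d) => η p.2 p.1 :=
        hmeas.comp measurable_swap
      simp only [Function.uncurry_def]
      fun_prop
    rw [hswap]
    calc _ = ∫⁻ z, ENNReal.ofReal (γ (z - x)) *
              ∫⁻ ω, ENNReal.ofReal (exp (c * η z ω)) ∂P := by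
          simp_rw [lintegral_const_mul' _ _ ENNReal.ofReal_ne_top]
      _ ≤ ∫⁻ z, ENNReal.ofReal (γ (z - x)) * ENNReal.ofReal C :=
          lintegral_mono fun z => mul_le_mul_right (hexp z) _
      _ = ENNReal.ofReal ((∫ z, γ z) * C) := by
          rw [lintegral_mul_const' _ _ ENNReal.ofReal_ne_top,
            lintegral_sub_right_eq_self (fun z => ENNReal.ofReal (γ z)) x,
            ENNReal.ofReal_mul (integral_nonneg fun z => (exp_pos _).le),
            ofReal_integral_eq_lintegral_ofReal hγi
              (Filter.Eventually.of_forall fun z => (exp_pos _).le)]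
  have hpoint : ∀ x ω, ENNReal.ofReal (exp (a * R x ω ^ 2)) ≤
      ENNReal.ofReal (exp c) * (1 + ENNReal.ofReal A * G x ω) := by
    intro x ω
    rw [hR]
    refine ofReal_exp_mul_iSup_sq_le _ x (by simp) ha fun y hy => ?_
    have hηm : Measurable fun z => c * η z ω :=
      (hmeas.comp measurable_prodMk_right).const_mul c
    set S := ∫ z, η z ω * χ (y - z) with hS
    have hS0 : 0 ≤ S := integral_nonneg fun z => mul_nonneg (hnonneg _ _) (hχnonneg _)
    have hJ := ofReal_exp_integral_mul_le (μ := volume) (w := fun z => χ (y - z)) hηm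
      (by fun_prop) (fun z => hχnonneg _) (hχi.comp_sub_left y)
      (by rw [integral_sub_left_eq_self χ volume y, hχint])
    simp_rw [mul_assoc c, integral_const_mul, ← hS] at hJ
    have hquad : a * (√(K * (1 + S)) - ‖y - x‖) ^ 2 ≤ c + (-a * ‖y - x‖ ^ 2 + c * S) := by
      have hsq := sq_sqrt (by positivity : 0 ≤ K * (1 + S))
      have h : (√(K * (1 + S)) - ‖y - x‖) ^ 2 ≤ K * (1 + S) - ‖y - x‖ ^ 2 := by
        nlinarith [norm_nonneg (y - x)]
      refine (mul_le_mul_of_nonneg_left h ha.le).trans_eq ?_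
      rw [← haK]
      ring
    have hdamp : ENNReal.ofReal (exp (-a * ‖y - x‖ ^ 2)) ≤ 1 := by
      rw [ENNReal.ofReal_le_one, exp_le_one_iff]
      nlinarith [sq_nonneg ‖y - x‖]
    calc _ ≤ ENNReal.ofReal (exp (c + (-a * ‖y - x‖ ^ 2 + c * S))) :=
          ENNReal.ofReal_le_ofReal (exp_le_exp.2 hquad)
      _ = ENNReal.ofReal (exp c) * (ENNReal.ofReal (exp (-a * ‖y - x‖ ^ 2)) *
            ENNReal.ofReal (exp (c * S))) := by
          rw [exp_add, exp_add, ENNReal.ofReal_mul (exp_pos _).le,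
            ENNReal.ofReal_mul (exp_pos _).le]
      _ ≤ ENNReal.ofReal (exp c) * (ENNReal.ofReal (exp (-a * ‖y - x‖ ^ 2)) *
            (1 + ∫⁻ z, ENNReal.ofReal (χ (y - z) * exp (c * η z ω)))) := by
          gcongr
      _ ≤ _ := by
          rw [mul_add, mul_one]
          refine mul_le_mul_right (add_le_add hdamp ?_) _
          rw [← lintegral_const_mul' _ _ ENNReal.ofReal_ne_top, hG_def,
            ← lintegral_const_mul' _ _ ENNReal.ofReal_ne_top]
          refine lintegral_mono fun z => ?_
          dsimp only
          rw [← ENNReal.ofReal_mul (exp_pos _).le, ← ENNReal.ofReal_mul (exp_pos _).le,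
            ← ENNReal.ofReal_mul hA]
          refine ENNReal.ofReal_le_ofReal ?_
          have h := mul_le_mul_of_nonneg_right (mul_exp_neg_sq_norm_le hM0 hM hr ha.le x y z)
            (exp_pos (c * η z ω)).le
          simp only [hA_def]
          linarith
  refine ⟨a, exp c * (1 + A * ((∫ z, γ z) * C)), ha, ?_, fun x => ?_⟩
  · have : 0 ≤ ∫ z, γ z := integral_nonneg fun z => (exp_pos _).le
    positivity
  have hI : 0 ≤ (∫ z, γ z) * C := mul_nonneg (integral_nonneg fun z => (exp_pos _).le) hC.le
  calc _ ≤ ∫⁻ ω, ENNReal.ofReal (exp c) * (1 + ENNReal.ofReal A * G x ω) ∂P :=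
        lintegral_mono (hpoint x)
    _ = ENNReal.ofReal (exp c) * (1 + ENNReal.ofReal A * ∫⁻ ω, G x ω ∂P) := by
        rw [lintegral_const_mul' _ _ ENNReal.ofReal_ne_top, lintegral_add_left measurable_const,
          lintegral_const_mul' _ _ ENNReal.ofReal_ne_top]
        simp
    _ ≤ ENNReal.ofReal (exp c) * (1 + ENNReal.ofReal A * ENNReal.ofReal ((∫ z, γ z) * C)) := by
        gcongr
        exact hGE x
    _ = _ := by
        rw [ENNReal.ofReal_mul (exp_pos _).le, ENNReal.ofReal_add zero_le_one (by positivity),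
          ENNReal.ofReal_mul hA, ENNReal.ofReal_one]
end
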